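/- arXiv:1308.0611 — 3 statements merged into one kernel-verified Lean document; each statement's English description precedes it below -/
import Mathlib

section
/- For every linear hypergraph H in which every edge has size at least 2 and at most r (where r ≥ 2), and in which no edge consists of twins, there exists an edge weighting ω : E(H) → {1, 2, ..., max(5, r+1)} such that the induced vertex weights properly color V(H), i.e., every edge of H contains at least two vertices with different induced weights. -/
section LinearHypergraph

variable {V ι : Type*} [Fintype ι] [DecidableEq V]

/-- The weight induced on the vertex `v` by the edge weighting `f`. -/
def inducedWeight (E : ι → Finset V) (f : ι → ℤ) (v : V) : ℤ :=
  ∑ j, if v ∈ E j then f j else 0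

theorem inducedWeight_congr {E : ι → Finset V} {f g : ι → ℤ} {v : V}
    (h : ∀ j, v ∈ E j → f j = g j) : inducedWeight E f v = inducedWeight E g v := by
  unfold inducedWeight
  refine Finset.sum_congr rfl fun j _ => ?_
  split_ifs with hj
  · exact h j hj
  · rfl

theorem inducedWeight_eq_add {E : ι → Finset V} {f g : ι → ℤ} {v : V} {e : ι} (he : v ∈ E e)
    (h : ∀ j, j ≠ e → v ∈ E j → g j = f j) :
    inducedWeight E g v = inducedWeight E f v + (g e - f e) := by
  classical
  have key : inducedWeight E g v - inducedWeight E f v = g e - f e := by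
    unfold inducedWeight
    rw [← Finset.sum_sub_distrib, Finset.sum_eq_single e]
    · simp [he]
    · intro j _ hj
      split_ifs with hv
      · rw [h j hj hv, sub_self]
      · simp
    · simp
  linarith

/-- The edges through `b` that meet `Q` in exactly one vertex. -/
def edgesTo (E : ι → Finset V) (Q : Finset V) (b : V) : Finset ι :=
  Finset.univ.filter fun e => b ∈ E e ∧ (E e ∩ Q).card = 1

theorem mem_edgesTo {E : ι → Finset V} {Q : Finset V} {b : V} {e : ι} :
    e ∈ edgesTo E Q b ↔ b ∈ E e ∧ (E e ∩ Q).card = 1 := by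
  simp [edgesTo]

/-- An edge weighting adapted to a set `Q` of processed vertices. The vertices of `N` have their
final weights. Every other vertex `a ∈ Q` has a weight in `{lo a, lo a + 2}`, and each edge meeting
`Q` only in `a` may still be changed by `2` so as to switch between these two weights.
Among these edges, only those in `S` may have a weight different from `3`. -/
structure AdaptedWeighting (E : ι → Finset V) (M : ℤ) (Q N : Finset V) (S : Set ι)
    (f : ι → ℤ) (lo : V → ℤ) : Prop where
  subset : N ⊆ Q
  card_ne_one : ∀ e, (E e ∩ N).card ≠ 1
  final : ∀ e, (∀ u ∈ E e, ∃ j, j ≠ e ∧ u ∈ E j) → (E e ∩ N).Nonempty →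
    ∃ a ∈ E e ∩ N, ∃ b ∈ E e ∩ N, inducedWeight E f a ≠ inducedWeight E f b
  bounds : ∀ e, 1 ≤ f e ∧ f e ≤ M
  untouched : ∀ e, E e ∩ Q = ∅ → f e = 3
  lo_mod : ∀ a ∈ Q, a ∉ N → lo a % 4 = 0 ∨ lo a % 4 = 1
  weight : ∀ a ∈ Q, a ∉ N → inducedWeight E f a = lo a ∨ inducedWeight E f a = lo a + 2
  pending : ∀ e a, E e ∩ Q = {a} → f e = 3 ∨
    (e ∈ S ∧ (f e = 2 ∧ inducedWeight E f a = lo a ∨ f e = 4 ∧ inducedWeight E f a = lo a + 2))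
  separated : ∀ e, E e ∩ N = ∅ → 2 ≤ (E e ∩ Q).card → ∃ a ∈ E e ∩ Q, ∃ b ∈ E e ∩ Q, lo a ≠ lo b

namespace AdaptedWeighting

variable {E : ι → Finset V} {M : ℤ} {Q N : Finset V} {S : Set ι} {f : ι → ℤ} {lo : V → ℤ}

theorem inter_eq_empty (h : AdaptedWeighting E M Q N S f lo) {e : ι} (he : (E e ∩ Q).card = 1) :
    E e ∩ N = ∅ := by
  have h1 := Finset.card_le_card (Finset.inter_subset_inter_left (s := E e) h.subset)
  have h2 := h.card_ne_one e
  rw [← Finset.card_eq_zero]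
  omega

theorem exists_switch (h : AdaptedWeighting E M Q N S f lo) (hM : 5 ≤ M)
    (hlin : ∀ i j, i ≠ j → (E i ∩ E j).card ≤ 1) {b : V} (hb : b ∉ Q) :
    ∃ A : ℤ, ∀ K ⊆ edgesTo E Q b, ∃ f' : ι → ℤ, (∀ e, 1 ≤ f' e ∧ f' e ≤ M) ∧
      (∀ e, e ∉ edgesTo E Q b → f' e = f e) ∧ inducedWeight E f' b = A + 2 * K.card ∧
      (∀ e ∈ edgesTo E Q b, ∀ a ∈ Q, a ∈ E e →
        (e ∈ K → inducedWeight E f' a = lo a + 2) ∧ (e ∉ K → inducedWeight E f' a = lo a)) := by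
  classical
  let low : ι → ℤ := fun e => f e - ∑ a ∈ E e ∩ Q, (inducedWeight E f a - lo a)
  have hlow : ∀ e a, E e ∩ Q = {a} → low e = f e - (inducedWeight E f a - lo a) := by
    intro e a he
    simp [low, he]
  refine ⟨inducedWeight E (fun e => if e ∈ edgesTo E Q b then low e else f e) b, fun K hK => ?_⟩
  let f' : ι → ℤ := fun e =>
    if e ∈ edgesTo E Q b then low e + (if e ∈ K then 2 else 0) else f e
  refine ⟨f', ?_, ?_, ?_, ?_⟩
  · intro e
    by_cases he : e ∈ edgesTo E Q b
    · obtain ⟨_, hc⟩ := mem_edgesTo.1 he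
      obtain ⟨a, ha⟩ := Finset.card_eq_one.1 hc
      have haQ : a ∈ E e ∩ Q := by simp [ha]
      have haN : a ∉ N := fun hN => by
        have := h.inter_eq_empty hc
        have h3 : a ∈ E e ∩ N := Finset.mem_inter.2 ⟨(Finset.mem_inter.1 haQ).1, hN⟩
        simp [this] at h3
      have hw := h.weight a (Finset.mem_inter.1 haQ).2 haN
      have hp := h.pending e a ha
      have hl := hlow e a ha
      simp only [f', if_pos he]
      split_ifs <;> constructor <;> omega
    · simp only [f', if_neg he]
      exact h.bounds e
  · intro e he
    simp only [f', if_neg he]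
  · have : inducedWeight E f' b
        - inducedWeight E (fun e => if e ∈ edgesTo E Q b then low e else f e) b
        = ∑ j, if j ∈ K then 2 else 0 := by
      unfold inducedWeight
      rw [← Finset.sum_sub_distrib]
      refine Finset.sum_congr rfl fun j _ => ?_
      by_cases hj : j ∈ K
      · have hD := hK hj
        simp [f', hj, hD, (mem_edgesTo.1 hD).1]
      · simp [f', hj]
    have h2 : (∑ j, if j ∈ K then (2 : ℤ) else 0) = 2 * K.card := by
      simp [mul_comm]
    linarith
  · intro e he a haQ hae
    obtain ⟨hbe, hc⟩ := mem_edgesTo.1 he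
    have ha : E e ∩ Q = {a} := by
      obtain ⟨a', ha'⟩ := Finset.card_eq_one.1 hc
      have : a ∈ E e ∩ Q := Finset.mem_inter.2 ⟨hae, haQ⟩
      rw [ha', Finset.mem_singleton] at this
      rw [ha', this]
    have hw : inducedWeight E f' a = inducedWeight E f a + (f' e - f e) := by
      refine inducedWeight_eq_add hae fun j hj haj => ?_
      have : j ∉ edgesTo E Q b := fun hD => by
        have h1 := hlin j e hj
        have hab : a ≠ b := fun hab => hb (hab ▸ haQ)
        exact hab (Finset.card_le_one.1 h1 a (Finset.mem_inter.2 ⟨haj, hae⟩) b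
          (Finset.mem_inter.2 ⟨(mem_edgesTo.1 hD).1, hbe⟩))
      simp only [f', if_neg this]
    have hl := hlow e a ha
    simp only [f', if_pos he] at hw
    constructor
    · intro hk
      rw [if_pos hk] at hw
      linarith
    · intro hk
      rw [if_neg hk] at hw
      linarith

theorem exists_ne_of_two_le_card (h : AdaptedWeighting E M Q N S f lo) {g : ι → ℤ}
    (hN : ∀ a ∈ N, inducedWeight E g a = inducedWeight E f a)
    (hQ : ∀ a ∈ Q, a ∉ N → inducedWeight E g a = lo a ∨ inducedWeight E g a = lo a + 2)
    {e : ι} (he : ∀ u ∈ E e, ∃ j, j ≠ e ∧ u ∈ E j) (hc : 2 ≤ (E e ∩ Q).card) :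
    ∃ a ∈ E e ∩ Q, ∃ b ∈ E e ∩ Q, inducedWeight E g a ≠ inducedWeight E g b := by
  by_cases hne : (E e ∩ N).Nonempty
  · obtain ⟨a, ha, b, hb, hab⟩ := h.final e he hne
    have hsub := Finset.inter_subset_inter_left (s := E e) h.subset
    refine ⟨a, hsub ha, b, hsub hb, ?_⟩
    rwa [hN a (Finset.mem_inter.1 ha).2, hN b (Finset.mem_inter.1 hb).2]
  · rw [Finset.not_nonempty_iff_eq_empty] at hne
    obtain ⟨a, ha, b, hb, hab⟩ := h.separated e hne hc
    have hnot : ∀ x ∈ E e ∩ Q, x ∉ N := fun x hx hxN => by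
      have : x ∈ E e ∩ N := Finset.mem_inter.2 ⟨(Finset.mem_inter.1 hx).1, hxN⟩
      simp [hne] at this
    refine ⟨a, ha, b, hb, ?_⟩
    have haQ := (Finset.mem_inter.1 ha).2
    have hbQ := (Finset.mem_inter.1 hb).2
    have h1 := hQ a haQ (hnot a ha)
    have h2 := hQ b hbQ (hnot b hb)
    have h3 := h.lo_mod a haQ (hnot a ha)
    have h4 := h.lo_mod b hbQ (hnot b hb)
    omega

theorem notMem_of_mem_edgesTo (h : AdaptedWeighting E M Q N S f lo) {b a : V} {e : ι}
    (he : e ∈ edgesTo E Q b) (ha : a ∈ N) : a ∉ E e := fun hae => by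
  have h1 := h.inter_eq_empty (mem_edgesTo.1 he).2
  have : a ∈ E e ∩ N := Finset.mem_inter.2 ⟨hae, ha⟩
  simp [h1] at this

theorem weight_of_switch (h : AdaptedWeighting E M Q N S f lo) {b : V} {K : Finset ι} {g : ι → ℤ}
    (hout : ∀ e, e ∉ edgesTo E Q b → g e = f e)
    (hin : ∀ e ∈ edgesTo E Q b, ∀ a ∈ Q, a ∈ E e →
      (e ∈ K → inducedWeight E g a = lo a + 2) ∧ (e ∉ K → inducedWeight E g a = lo a)) :
    (∀ a ∈ N, inducedWeight E g a = inducedWeight E f a) ∧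
      ∀ a ∈ Q, a ∉ N → inducedWeight E g a = lo a ∨ inducedWeight E g a = lo a + 2 := by
  constructor
  · intro a ha
    exact inducedWeight_congr fun j hj =>
      hout j fun hD => h.notMem_of_mem_edgesTo hD ha hj
  · intro a ha haN
    by_cases hex : ∃ e ∈ edgesTo E Q b, a ∈ E e
    · obtain ⟨e, he, hae⟩ := hex
      by_cases hk : e ∈ K
      · exact Or.inr ((hin e he a ha hae).1 hk)
      · exact Or.inl ((hin e he a ha hae).2 hk)
    · push Not at hex
      rw [inducedWeight_congr fun j hj => hout j fun hD => hex j hD hj]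
      exact h.weight a ha haN

end AdaptedWeighting

theorem exists_residue_avoiding (A : ℤ) (d : ℕ) (T : Finset ℤ) (hT : T.card ≤ d) :
    ∃ k ≤ d, ∃ ε L : ℤ, L ∉ T ∧ (L % 4 = 0 ∨ L % 4 = 1) ∧
      (ε = 0 ∧ (A + 2 * k + ε = L ∨ A + 2 * k + ε = L + 2) ∨ ε = -1 ∧ A + 2 * k + ε = L ∨
        ε = 1 ∧ A + 2 * k + ε = L + 2) := by
  have pigeon : ∀ c : ℕ → ℤ, Function.Injective c → ∃ k ≤ d, c k ∉ T := by
    intro c hc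
    have hcard : T.card < ((Finset.range (d + 1)).image c).card := by
      rw [Finset.card_image_of_injective _ hc, Finset.card_range]
      omega
    obtain ⟨x, hx, hxT⟩ := Finset.exists_mem_notMem_of_card_lt_card hcard
    obtain ⟨k, hk, rfl⟩ := Finset.mem_image.1 hx
    exact ⟨k, by simpa [Nat.lt_succ_iff] using hk, hxT⟩
  have hA : A % 4 = 0 ∨ A % 4 = 1 ∨ A % 4 = 2 ∨ A % 4 = 3 := by omega
  rcases hA with hA | hA | hA | hA
  · obtain ⟨k, hk, hkT⟩ := pigeon (fun k => if k % 2 = 0 then A + 2 * k else A + 2 * k - 1)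
      (by intro x y hxy; dsimp only at hxy; split_ifs at hxy <;> omega)
    split_ifs at hkT with hp
    · exact ⟨k, hk, 0, _, hkT, by omega, by omega⟩
    · exact ⟨k, hk, -1, _, hkT, by omega, by omega⟩
  · obtain ⟨k, hk, hkT⟩ := pigeon (fun k => if k % 2 = 0 then A + 2 * k else A + 2 * k - 3)
      (by intro x y hxy; dsimp only at hxy; split_ifs at hxy <;> omega)
    split_ifs at hkT with hp
    · exact ⟨k, hk, 0, _, hkT, by omega, by omega⟩
    · exact ⟨k - 1, by omega, -1, _, hkT, by omega, by omega⟩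
  · obtain ⟨k, hk, hkT⟩ := pigeon (fun k => if k % 2 = 0 then A + 2 * k - 2 else A + 2 * k - 3)
      (by intro x y hxy; dsimp only at hxy; split_ifs at hxy <;> omega)
    split_ifs at hkT with hp
    · exact ⟨k, hk, 0, _, hkT, by omega, by omega⟩
    · exact ⟨k - 1, by omega, -1, _, hkT, by omega, by omega⟩
  · obtain ⟨k, hk, hkT⟩ := pigeon (fun k => if k % 2 = 0 then A + 2 * k - 2 else A + 2 * k - 1)
      (by intro x y hxy; dsimp only at hxy; split_ifs at hxy <;> omega)
    split_ifs at hkT with hp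
    · exact ⟨k, hk, 0, _, hkT, by omega, by omega⟩
    · exact ⟨k, hk, -1, _, hkT, by omega, by omega⟩

/-- Choice of the switches at a last vertex: `l e` is the lower weight of the neighbor along the
edge `e`. -/
theorem exists_switch_set {ι : Type*} [DecidableEq ι] (A : ℤ) (D : Finset ι) (hD : D.card ≠ 1) (l : ι → ℤ)
    (hl : ∀ e ∈ D, l e % 4 = 0 ∨ l e % 4 = 1) :
    ∃ K ⊆ D, ∀ e ∈ D, (e ∈ K → A + 2 * (K.card : ℤ) ≠ l e + 2) ∧
      (e ∉ K → A + 2 * (K.card : ℤ) ≠ l e) := by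
  by_cases h0 : ∃ e ∈ D, l e = A
  · obtain ⟨e₀, he₀, hA⟩ := h0
    have hmod := hl e₀ he₀
    by_cases h1 : ∃ e ∈ D, l e ≠ A
    · obtain ⟨e₁, he₁, hne⟩ := h1
      refine ⟨{e₁}, by simpa using he₁, fun e he => ⟨?_, ?_⟩⟩
      · intro hk
        rw [Finset.mem_singleton] at hk
        subst hk
        simp only [Finset.card_singleton]
        push_cast
        omega
      · intro _
        have := hl e he
        simp only [Finset.card_singleton]
        push_cast
        omega
    · push Not at h1
      have h2 : 1 < D.card := by
        have : 0 < D.card := Finset.card_pos.2 ⟨e₀, he₀⟩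
        omega
      obtain ⟨K, hK, hc⟩ := Finset.exists_subset_card_eq h2
      refine ⟨K, hK, fun e he => ?_⟩
      have := h1 e he
      rw [hc]
      constructor <;> intro _ <;> push_cast <;> omega
  · push Not at h0
    refine ⟨∅, by simp, fun e he => ⟨by simp, fun _ => ?_⟩⟩
    have := h0 e he
    simp
    omega

theorem AdaptedWeighting.exists_insert {E : ι → Finset V} {M : ℤ} {Q N : Finset V} {S S' : Set ι}
    {f : ι → ℤ} {lo : V → ℤ} (h : AdaptedWeighting E M Q N S' f lo) (hM : 5 ≤ M)
    (hlin : ∀ i j, i ≠ j → (E i ∩ E j).card ≤ 1) {b : V} (hb : b ∉ Q) {s : ι} (hs : s ∈ S)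
    (hsb : E s ∩ insert b Q = {b})
    (hS : ∀ e ∈ S', ∀ a, E e ∩ Q = {a} → b ∉ E e →
      e ∈ S ∧ ∀ e', b ∈ E e' → E e' ∩ Q ≠ {a}) :
    ∃ (f' : ι → ℤ) (lo' : V → ℤ), AdaptedWeighting E M (insert b Q) N S f' lo' := by
  classical
  obtain ⟨A, hA⟩ := h.exists_switch hM hlin hb
  have hcard : (((edgesTo E Q b).biUnion fun e => E e ∩ Q).image lo).card
      ≤ (edgesTo E Q b).card := by
    refine Finset.card_image_le.trans (Finset.card_biUnion_le.trans ?_)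
    rw [Finset.sum_congr rfl fun e he => (mem_edgesTo.1 he).2]
    simp
  obtain ⟨k, hk, ε, L, hLT, hL, hε⟩ := exists_residue_avoiding A _ _ hcard
  obtain ⟨K, hK, rfl⟩ := Finset.exists_subset_card_eq hk
  obtain ⟨f', hbd, hout, hwb, hin⟩ := hA K hK
  obtain ⟨hwN, hwQ⟩ := h.weight_of_switch hout hin
  have hbs : b ∈ E s := by
    have : b ∈ E s ∩ insert b Q := by simp [hsb]
    exact (Finset.mem_inter.1 this).1
  have hsQ : ∀ a ∈ Q, a ∉ E s := fun a ha has => by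
    have : a ∈ E s ∩ insert b Q := Finset.mem_inter.2 ⟨has, Finset.mem_insert_of_mem ha⟩
    rw [hsb, Finset.mem_singleton] at this
    exact hb (this ▸ ha)
  have hsE : E s ∩ Q = ∅ := by
    rw [← Finset.disjoint_iff_inter_eq_empty, Finset.disjoint_right]
    exact fun a ha => hsQ a ha
  have hsD : s ∉ edgesTo E Q b := fun hD => by
    have := (mem_edgesTo.1 hD).2
    simp [hsE] at this
  have hs3 : f' s = 3 := by rw [hout s hsD, h.untouched s hsE]
  have hbN : b ∉ N := fun hN => hb (h.subset hN)
  have hneb : ∀ a ∈ Q, a ≠ b := fun a ha hab => hb (hab ▸ ha)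
  let g : ι → ℤ := Function.update f' s (3 + ε)
  have hgs : g s = 3 + ε := by simp [g]
  have hg : ∀ e, e ≠ s → g e = f' e := fun e he => by simp [g, he]
  have hgQ : ∀ a ∈ Q, inducedWeight E g a = inducedWeight E f' a := fun a ha =>
    inducedWeight_congr fun j hj => hg j fun hjs => hsQ a ha (hjs ▸ hj)
  have hgb : inducedWeight E g b = A + 2 * K.card + ε := by
    rw [inducedWeight_eq_add hbs fun j hj _ => hg j hj, hwb, hgs, hs3]
    ring
  have hins : ∀ e, b ∉ E e → E e ∩ insert b Q = E e ∩ Q := fun e he =>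
    Finset.inter_insert_of_notMem he
  refine ⟨g, Function.update lo b L, ?_, h.card_ne_one, ?_, ?_, ?_, ?_, ?_, ?_, ?_⟩
  · exact h.subset.trans (Finset.subset_insert _ _)
  · intro e he hne
    obtain ⟨x, hx, y, hy, hxy⟩ := h.final e he hne
    refine ⟨x, hx, y, hy, ?_⟩
    have hxN := (Finset.mem_inter.1 hx).2
    have hyN := (Finset.mem_inter.1 hy).2
    rwa [hgQ x (h.subset hxN), hgQ y (h.subset hyN), hwN x hxN, hwN y hyN]
  · intro e
    by_cases hes : e = s
    · subst hes
      rw [hgs]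
      omega
    · rw [hg e hes]
      exact hbd e
  · intro e he
    have hbe : b ∉ E e := fun hbe => by
      have : b ∈ E e ∩ insert b Q := by simp [hbe]
      simp [he] at this
    rw [hg e fun hes => hbe (hes ▸ hbs), hout e fun hD => hbe (mem_edgesTo.1 hD).1]
    exact h.untouched e (hins e hbe ▸ he)
  · intro a ha haN
    rcases Finset.mem_insert.1 ha with rfl | haQ
    · simpa using hL
    · rw [Function.update_of_ne (hneb a haQ)]
      exact h.lo_mod a haQ haN
  · intro a ha haN
    rcases Finset.mem_insert.1 ha with rfl | haQ
    · rw [Function.update_self, hgb]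
      omega
    · rw [Function.update_of_ne (hneb a haQ), hgQ a haQ]
      exact hwQ a haQ haN
  · intro e a hea
    have hae : a ∈ E e ∩ insert b Q := by simp [hea]
    rcases Finset.mem_insert.1 (Finset.mem_inter.1 hae).2 with rfl | haQ
    · by_cases hes : e = s
      · subst hes
        rw [hgs, Function.update_self, hgb]
        rcases hε with hε | hε | hε
        · left
          omega
        · exact Or.inr ⟨hs, by omega⟩
        · exact Or.inr ⟨hs, by omega⟩
      · left
        have heQ : E e ∩ Q = ∅ := by
          rw [← Finset.disjoint_iff_inter_eq_empty, Finset.disjoint_right]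
          intro x hx hxe
          have : x ∈ E e ∩ insert a Q := Finset.mem_inter.2 ⟨hxe, Finset.mem_insert_of_mem hx⟩
          rw [hea, Finset.mem_singleton] at this
          exact hneb x hx this
        rw [hg e hes, hout e fun hD => by simpa [heQ] using (mem_edgesTo.1 hD).2]
        exact h.untouched e heQ
    · have hbe : b ∉ E e := fun hbe => by
        have : b ∈ E e ∩ insert b Q := by simp [hbe]
        rw [hea, Finset.mem_singleton] at this
        exact hneb a haQ this.symm
      rw [hins e hbe] at hea
      rw [hg e fun hes => hbe (hes ▸ hbs), hout e fun hD => hbe (mem_edgesTo.1 hD).1,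
        Function.update_of_ne (hneb a haQ), hgQ a haQ]
      rcases h.pending e a hea with h3 | ⟨heS, hw⟩
      · exact Or.inl h3
      · obtain ⟨heS, hno⟩ := hS e heS a hea hbe
        refine Or.inr ⟨heS, ?_⟩
        rwa [inducedWeight_congr fun j hj => hout j fun hD => ?_]
        obtain ⟨hbj, hc⟩ := mem_edgesTo.1 hD
        obtain ⟨x, hx⟩ := Finset.card_eq_one.1 hc
        have hax : a ∈ E j ∩ Q := Finset.mem_inter.2 ⟨hj, haQ⟩
        rw [hx, Finset.mem_singleton] at hax
        exact hno j hbj (hax ▸ hx)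
  · intro e heN hc
    by_cases h2 : 2 ≤ (E e ∩ Q).card
    · obtain ⟨x, hx, y, hy, hxy⟩ := h.separated e heN h2
      have hsub := Finset.inter_subset_inter_left (s := E e) (Finset.subset_insert b Q)
      refine ⟨x, hsub hx, y, hsub hy, ?_⟩
      rwa [Function.update_of_ne (hneb x (Finset.mem_inter.1 hx).2),
        Function.update_of_ne (hneb y (Finset.mem_inter.1 hy).2)]
    · have hbe : b ∈ E e := by
        by_contra hbe
        rw [hins e hbe] at hc
        exact h2 hc
      rw [Finset.inter_insert_of_mem hbe, Finset.card_insert_of_notMem (by simp [hb])] at hc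
      have h1 : (E e ∩ Q).card = 1 := by omega
      obtain ⟨a, ha⟩ := Finset.card_eq_one.1 h1
      have hae : a ∈ E e ∩ Q := by simp [ha]
      obtain ⟨hae', haQ⟩ := Finset.mem_inter.1 hae
      refine ⟨a, by simp [hae', haQ], b, by simp [hbe], ?_⟩
      rw [Function.update_of_ne (hneb a haQ), Function.update_self]
      intro hL'
      exact hLT (Finset.mem_image.2 ⟨a, Finset.mem_biUnion.2
        ⟨e, mem_edgesTo.2 ⟨hbe, h1⟩, hae⟩, hL'⟩)

/-- If no edge meets `Q` in exactly one vertex and `v ∈ Q` is not in exactly one edge of trace two,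
the vertex `v` can be processed last. -/
theorem AdaptedWeighting.exists_final_insert {E : ι → Finset V} {M : ℤ} {Q N : Finset V}
    {S : Set ι} {f : ι → ℤ} {lo : V → ℤ} (h : AdaptedWeighting E M Q N S f lo) (hM : 5 ≤ M)
    (hlin : ∀ i j, i ≠ j → (E i ∩ E j).card ≤ 1) {v : V} (hv : v ∉ Q)
    (hclosed : ∀ e, (E e ∩ insert v Q).card ≠ 1) (hD : (edgesTo E Q v).card ≠ 1) :
    ∃ f' : ι → ℤ, (∀ e, 1 ≤ f' e ∧ f' e ≤ M) ∧ (∀ e, E e ∩ insert v Q = ∅ → f' e = 3) ∧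
      ∀ e, (∀ u ∈ E e, ∃ j, j ≠ e ∧ u ∈ E j) → (E e ∩ insert v Q).Nonempty →
        ∃ a ∈ E e ∩ insert v Q, ∃ b ∈ E e ∩ insert v Q,
          inducedWeight E f' a ≠ inducedWeight E f' b := by
  classical
  obtain ⟨A, hA⟩ := h.exists_switch hM hlin hv
  have hsum : ∀ e a, E e ∩ Q = {a} → ∑ x ∈ E e ∩ Q, lo x = lo a := fun e a he => by simp [he]
  obtain ⟨K, hK, hKne⟩ := exists_switch_set A (edgesTo E Q v) hD (fun e => ∑ x ∈ E e ∩ Q, lo x) (by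
    intro e he
    obtain ⟨a, ha⟩ := Finset.card_eq_one.1 (mem_edgesTo.1 he).2
    have hae : a ∈ E e ∩ Q := by simp [ha]
    rw [hsum e a ha]
    exact h.lo_mod a (Finset.mem_inter.1 hae).2 fun haN =>
      h.notMem_of_mem_edgesTo he haN (Finset.mem_inter.1 hae).1)
  obtain ⟨f', hbd, hout, hwv, hin⟩ := hA K hK
  obtain ⟨hwN, hwQ⟩ := h.weight_of_switch hout hin
  refine ⟨f', hbd, ?_, ?_⟩
  · intro e he
    have hve : v ∉ E e := fun hve => by
      have : v ∈ E e ∩ insert v Q := by simp [hve]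
      simp [he] at this
    rw [hout e fun hD => hve (mem_edgesTo.1 hD).1]
    exact h.untouched e (Finset.inter_insert_of_notMem hve ▸ he)
  · intro e he hne
    have hpos := Finset.card_pos.2 hne
    have h1 := hclosed e
    by_cases h2 : 2 ≤ (E e ∩ Q).card
    · obtain ⟨a, ha, b, hb, hab⟩ := h.exists_ne_of_two_le_card hwN hwQ he h2
      have hsub := Finset.inter_subset_inter_left (s := E e) (Finset.subset_insert v Q)
      exact ⟨a, hsub ha, b, hsub hb, hab⟩
    · have hve : v ∈ E e := by
        by_contra hve
        rw [Finset.inter_insert_of_notMem hve] at hpos h1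
        omega
      rw [Finset.inter_insert_of_mem hve, Finset.card_insert_of_notMem (by simp [hv])] at h1
      have hc : (E e ∩ Q).card = 1 := by omega
      have heD : e ∈ edgesTo E Q v := mem_edgesTo.2 ⟨hve, hc⟩
      obtain ⟨a, ha⟩ := Finset.card_eq_one.1 hc
      have hae : a ∈ E e ∩ Q := by simp [ha]
      obtain ⟨hae', haQ⟩ := Finset.mem_inter.1 hae
      refine ⟨v, by simp [hve], a, by simp [hae', haQ], ?_⟩
      have hin' := hin e heD a haQ hae'
      have hK' := hKne e heD
      rw [hsum e a ha] at hK'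
      rw [hwv]
      by_cases hk : e ∈ K
      · rw [hin'.1 hk]
        exact hK'.1 hk
      · rw [hin'.2 hk]
        exact hK'.2 hk

/-- If every vertex of `Q` lies in exactly one edge of trace two and no edge has trace one,
then the vertices of an edge `g` of larger trace can be processed last. -/
theorem AdaptedWeighting.exists_final_union {E : ι → Finset V} {M : ℤ} {Q N : Finset V}
    {S : Set ι} {f : ι → ℤ} {lo : V → ℤ} {g : ι}
    (h : AdaptedWeighting E M (Q \ E g) N S f lo) (hM : 5 ≤ M)
    (hlin : ∀ i j, i ≠ j → (E i ∩ E j).card ≤ 1)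
    (hclosed : ∀ e, (E e ∩ Q).card ≠ 1) (hg : 3 ≤ (E g ∩ Q).card) (hgM : ((E g).card : ℤ) < M)
    (hmatch : ∀ v ∈ Q, (edgesTo E (Q.erase v) v).card = 1) :
    ∃ f' : ι → ℤ, (∀ e, 1 ≤ f' e ∧ f' e ≤ M) ∧ (∀ e, E e ∩ Q = ∅ → f' e = 3) ∧
      ∀ e, (∀ u ∈ E e, ∃ j, j ≠ e ∧ u ∈ E j) → (E e ∩ Q).Nonempty →
        ∃ a ∈ E e ∩ Q, ∃ b ∈ E e ∩ Q, inducedWeight E f' a ≠ inducedWeight E f' b := by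
  classical
  have inj : ∀ e, e ≠ g → ∀ x ∈ E e, x ∈ E g → ∀ y ∈ E e, y ∈ E g → x = y :=
    fun e he x hx hxg y hy hyg => Finset.card_le_one.1 (hlin e g he) x
      (Finset.mem_inter.2 ⟨hx, hxg⟩) y (Finset.mem_inter.2 ⟨hy, hyg⟩)
  -- the partner of a vertex of `g`
  have partner : ∀ x ∈ E g ∩ Q, ∃ m ≠ g, x ∈ E m ∧ ∃ y ∈ Q \ E g, E m ∩ (Q \ E g) = {y} ∧
      ∀ e ≠ g, x ∈ E e → (E e ∩ (Q \ E g)).card ≤ 1 → e = m := by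
    intro x hx
    obtain ⟨hxg, hxQ⟩ := Finset.mem_inter.1 hx
    have hsplit : ∀ e ≠ g, x ∈ E e → E e ∩ (Q \ E g) = E e ∩ Q.erase x := by
      intro e he hxe
      ext z
      simp only [Finset.mem_inter, Finset.mem_sdiff, Finset.mem_erase]
      constructor
      · rintro ⟨hz, hzQ, hzg⟩
        exact ⟨hz, fun hzx => hzg (hzx ▸ hxg), hzQ⟩
      · rintro ⟨hz, hzx, hzQ⟩
        exact ⟨hz, hzQ, fun hzg => hzx (inj e he z hz hzg x hxe hxg)⟩
    have herase : ∀ e, x ∈ E e → (E e ∩ Q.erase x).card + 1 = (E e ∩ Q).card := by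
      intro e hxe
      rw [Finset.inter_erase, Finset.card_erase_add_one (Finset.mem_inter.2 ⟨hxe, hxQ⟩)]
    obtain ⟨m, hm⟩ := Finset.card_eq_one.1 (hmatch x hxQ)
    have hmD : m ∈ edgesTo E (Q.erase x) x := by simp [hm]
    obtain ⟨hxm, hmc⟩ := mem_edgesTo.1 hmD
    have hmg : m ≠ g := by
      rintro rfl
      have := herase m hxm
      omega
    obtain ⟨y, hy⟩ := Finset.card_eq_one.1 hmc
    rw [← hsplit m hmg hxm] at hy
    have hyy : y ∈ E m ∩ (Q \ E g) := by simp [hy]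
    refine ⟨m, hmg, hxm, y, (Finset.mem_inter.1 hyy).2, hy, fun e he hxe hc => ?_⟩
    have : e ∈ edgesTo E (Q.erase x) x := by
      refine mem_edgesTo.2 ⟨hxe, ?_⟩
      rw [hsplit e he hxe] at hc
      have h1 := herase e hxe
      have h2 := hclosed e
      omega
    simpa [hm] using this
  obtain ⟨x₁, hx₁, x₂, hx₂, hx₁₂⟩ := Finset.one_lt_card.1 (show 1 < (E g ∩ Q).card by omega)
  obtain ⟨hx₁g, hx₁Q⟩ := Finset.mem_inter.1 hx₁
  obtain ⟨hx₂g, hx₂Q⟩ := Finset.mem_inter.1 hx₂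
  have hgQ : E g ∩ (Q \ E g) = ∅ := by simp
  have hgD : g ∉ edgesTo E (Q \ E g) x₁ := fun hD => by
    have := (mem_edgesTo.1 hD).2
    simp [hgQ] at this
  -- switch one edge in order to distinguish two vertices of `g`
  have hswitch : ∃ (K : Finset ι) (f' : ι → ℤ), (∀ e, 1 ≤ f' e ∧ f' e ≤ M) ∧
      (∀ e, e ∉ edgesTo E (Q \ E g) x₁ → f' e = f e) ∧
      inducedWeight E f' x₁ ≠ inducedWeight E f' x₂ ∧
      (∀ e ∈ edgesTo E (Q \ E g) x₁, ∀ a ∈ Q \ E g, a ∈ E e →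
        (e ∈ K → inducedWeight E f' a = lo a + 2) ∧ (e ∉ K → inducedWeight E f' a = lo a)) := by
    obtain ⟨A, hA⟩ := h.exists_switch hM hlin (b := x₁) (by simp [hx₁g])
    have hx₂w : ∀ f' : ι → ℤ, (∀ e, e ∉ edgesTo E (Q \ E g) x₁ → f' e = f e) →
        inducedWeight E f' x₂ = inducedWeight E f x₂ := by
      intro f' hout
      refine inducedWeight_congr fun j hj => hout j fun hD => ?_
      have hjg : j ≠ g := by
        rintro rfl
        exact hgD hD
      exact hx₁₂ (inj j hjg x₁ (mem_edgesTo.1 hD).1 hx₁g x₂ hj hx₂g)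
    by_cases hAx : A = inducedWeight E f x₂
    · obtain ⟨m, hmg, hx₁m, y, hy, hmy, -⟩ := partner x₁ hx₁
      have hmD : m ∈ edgesTo E (Q \ E g) x₁ := mem_edgesTo.2 ⟨hx₁m, by simp [hmy]⟩
      obtain ⟨f', hbd, hout, hw, hin⟩ := hA {m} (by simpa using hmD)
      refine ⟨{m}, f', hbd, hout, ?_, hin⟩
      rw [hx₂w f' hout, hw, hAx]
      simp
    · obtain ⟨f', hbd, hout, hw, hin⟩ := hA ∅ (by simp)
      refine ⟨∅, f', hbd, hout, ?_, hin⟩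
      rw [hx₂w f' hout, hw]
      simpa using hAx
  obtain ⟨K, f', hbd, hout, hne, hin⟩ := hswitch
  obtain ⟨hwN, hwQ⟩ := h.weight_of_switch hout hin
  -- choose the weight of `g` so as to distinguish all partners
  choose! m hmg hxm p hpQ hmp huniq using partner
  obtain ⟨c, hc, hcT⟩ : ∃ c ∈ Finset.Icc (1 : ℤ) M, c ∉ (E g ∩ Q).image fun x =>
      inducedWeight E f' (p x) - inducedWeight E f' x + f' g := by
    refine Finset.exists_mem_notMem_of_card_lt_card ?_
    have h1 : ((E g ∩ Q).image fun x =>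
        inducedWeight E f' (p x) - inducedWeight E f' x + f' g).card ≤ (E g).card :=
      Finset.card_image_le.trans (Finset.card_le_card Finset.inter_subset_left)
    rw [Int.card_Icc]
    omega
  let f₂ : ι → ℤ := Function.update f' g c
  have hf₂ : ∀ e, e ≠ g → f₂ e = f' e := fun e he => by simp [f₂, he]
  have hf₂g : f₂ g = c := by simp [f₂]
  have hw_out : ∀ a, a ∉ E g → inducedWeight E f₂ a = inducedWeight E f' a := fun a ha =>
    inducedWeight_congr fun j hj => hf₂ j fun hjg => ha (hjg ▸ hj)
  have hw_in : ∀ a ∈ E g, inducedWeight E f₂ a = inducedWeight E f' a + (c - f' g) :=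
    fun a ha => by rw [inducedWeight_eq_add ha fun j hj _ => hf₂ j hj, hf₂g]
  refine ⟨f₂, ?_, ?_, ?_⟩
  · intro e
    by_cases he : e = g
    · subst he
      rw [hf₂g]
      exact Finset.mem_Icc.1 hc
    · rw [hf₂ e he]
      exact hbd e
  · intro e he
    have heg : e ≠ g := by
      rintro rfl
      simp [he] at hg
    have hx₁e : x₁ ∉ E e := fun hx => by
      have : x₁ ∈ E e ∩ Q := Finset.mem_inter.2 ⟨hx, hx₁Q⟩
      simp [he] at this
    rw [hf₂ e heg, hout e fun hD => hx₁e (mem_edgesTo.1 hD).1]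
    refine h.untouched e (Finset.subset_empty.1 ?_)
    rw [← he]
    exact Finset.inter_subset_inter_left Finset.sdiff_subset
  · intro e he hne'
    by_cases heg : e = g
    · subst heg
      refine ⟨x₁, hx₁, x₂, hx₂, ?_⟩
      rw [hw_in x₁ hx₁g, hw_in x₂ hx₂g]
      simpa using hne
    have hsub := Finset.inter_subset_inter_left (s := E e) (Finset.sdiff_subset (s := Q) (t := E g))
    by_cases h2 : 2 ≤ (E e ∩ (Q \ E g)).card
    · have hQg : ∀ a ∈ Q \ E g, inducedWeight E f₂ a = inducedWeight E f' a := fun a ha =>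
        hw_out a (Finset.mem_sdiff.1 ha).2
      obtain ⟨a, ha, b, hb, hab⟩ := h.exists_ne_of_two_le_card (g := f₂)
        (fun a ha => by rw [hQg a (h.subset ha), hwN a ha])
        (fun a ha haN => by rw [hQg a ha]; exact hwQ a ha haN) he h2
      exact ⟨a, hsub ha, b, hsub hb, hab⟩
    · have hex : ∃ x ∈ E e, x ∈ E g ∩ Q := by
        by_contra hno
        push Not at hno
        have heq : E e ∩ (Q \ E g) = E e ∩ Q := by
          ext z
          simp only [Finset.mem_inter, Finset.mem_sdiff]
          exact ⟨fun hz => ⟨hz.1, hz.2.1⟩, fun hz => ⟨hz.1, hz.2, fun hzg =>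
            hno z hz.1 (Finset.mem_inter.2 ⟨hzg, hz.2⟩)⟩⟩
        have h3 := hclosed e
        have h4 := Finset.card_pos.2 hne'
        rw [heq] at h2
        omega
      obtain ⟨x, hxe, hx⟩ := hex
      have hem := huniq x hx e heg hxe (by omega)
      have hpe : p x ∈ E e ∩ (Q \ E g) := by
        rw [hem, hmp x hx]
        simp
      refine ⟨x, Finset.mem_inter.2 ⟨hxe, (Finset.mem_inter.1 hx).2⟩, p x, hsub hpe, ?_⟩
      rw [hw_in x (Finset.mem_inter.1 hx).1, hw_out (p x) (Finset.mem_sdiff.1 (hpQ x hx)).2]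
      intro heq
      exact hcT (Finset.mem_image.2 ⟨x, hx, by linarith⟩)

theorem exists_adaptedWeighting {E : ι → Finset V} {M : ℤ} (hM : 5 ≤ M)
    (hlin : ∀ i j, i ≠ j → (E i ∩ E j).card ≤ 1) (hEM : ∀ e, ((E e).card : ℤ) < M)
    (Q : Finset V) :
    ∀ S : Set ι, (∀ a, (∃ e, E e ∩ Q = {a}) → ∃ e ∈ S, E e ∩ Q = {a}) →
      ∃ N f lo, AdaptedWeighting E M Q N S f lo ∧ ((∀ e, (E e ∩ Q).card ≠ 1) → N = Q) := by
  classical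
  induction Q using Finset.strongInduction with
  | H Q ih =>
  intro S hS
  by_cases hclosed : ∀ e, (E e ∩ Q).card ≠ 1
  · suffices hmain : ∃ f' : ι → ℤ, (∀ e, 1 ≤ f' e ∧ f' e ≤ M) ∧ (∀ e, E e ∩ Q = ∅ → f' e = 3) ∧
        ∀ e, (∀ u ∈ E e, ∃ j, j ≠ e ∧ u ∈ E j) → (E e ∩ Q).Nonempty →
          ∃ a ∈ E e ∩ Q, ∃ b ∈ E e ∩ Q, inducedWeight E f' a ≠ inducedWeight E f' b by
      obtain ⟨f', hbd, hun, hfin⟩ := hmain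
      refine ⟨Q, f', fun _ => 0, ⟨subset_rfl, hclosed, hfin, hbd, hun, ?_, ?_, ?_, ?_⟩,
        fun _ => rfl⟩
      · exact fun a ha haQ => absurd ha haQ
      · exact fun a ha haQ => absurd ha haQ
      · exact fun e a hea => absurd (by simp [hea]) (hclosed e)
      · intro e he hc
        simp [he] at hc
    by_cases hv : ∃ v ∈ Q, (edgesTo E (Q.erase v) v).card ≠ 1
    · obtain ⟨v, hvQ, hD⟩ := hv
      obtain ⟨N, f, lo, h, -⟩ := ih (Q.erase v) (Finset.erase_ssubset hvQ) Set.univ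
        (fun a ⟨e, he⟩ => ⟨e, trivial, he⟩)
      have := h.exists_final_insert hM hlin (Finset.notMem_erase v Q)
      rw [Finset.insert_erase hvQ] at this
      exact this hclosed hD
    push Not at hv
    by_cases hg : ∃ g, 3 ≤ (E g ∩ Q).card
    · obtain ⟨g, hg⟩ := hg
      obtain ⟨x, hx⟩ := Finset.card_pos.1 (show 0 < (E g ∩ Q).card by omega)
      obtain ⟨hxg, hxQ⟩ := Finset.mem_inter.1 hx
      obtain ⟨N, f, lo, h, -⟩ := ih (Q \ E g)
        ⟨Finset.sdiff_subset, fun hsub => (Finset.mem_sdiff.1 (hsub hxQ)).2 hxg⟩ Set.univ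
        (fun a ⟨e, he⟩ => ⟨e, trivial, he⟩)
      exact h.exists_final_union hM hlin hclosed hg (hEM g) hv
    · push Not at hg
      refine ⟨fun _ => 3, fun _ => ⟨by norm_num, by linarith⟩, fun _ _ => rfl, fun e he hne => ?_⟩
      obtain ⟨x, hx⟩ := hne
      obtain ⟨hxe, hxQ⟩ := Finset.mem_inter.1 hx
      obtain ⟨j, hj, hxj⟩ := he x hxe
      have hmem : ∀ i, x ∈ E i → i ∈ edgesTo E (Q.erase x) x := by
        intro i hi
        have hxi : x ∈ E i ∩ Q := Finset.mem_inter.2 ⟨hi, hxQ⟩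
        have h1 := hclosed i
        have h2 := hg i
        have h3 := Finset.card_pos.2 ⟨x, hxi⟩
        refine mem_edgesTo.2 ⟨hi, ?_⟩
        rw [Finset.inter_erase, Finset.card_erase_of_mem hxi]
        omega
      exact absurd (Finset.card_le_one.1 (hv x hxQ).le j (hmem j hxj) e (hmem e hxe)) hj
  · push Not at hclosed
    obtain ⟨e₀, he₀⟩ := hclosed
    obtain ⟨b, hb⟩ := Finset.card_eq_one.1 he₀
    obtain ⟨s, hsS, hsb⟩ := hS b ⟨e₀, hb⟩
    have hbQ : b ∈ Q := by
      have : b ∈ E e₀ ∩ Q := by simp [hb]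
      exact (Finset.mem_inter.1 this).2
    have hsame : ∀ e, b ∉ E e → E e ∩ Q = E e ∩ Q.erase b := fun e he => by
      rw [Finset.inter_erase, Finset.erase_eq_of_notMem (by simp [he])]
    obtain ⟨N, f, lo, h, -⟩ := ih (Q.erase b) (Finset.erase_ssubset hbQ)
      {e | ∀ a, E e ∩ Q.erase b = {a} → b ∉ E e →
        e ∈ S ∧ ∀ e', b ∈ E e' → E e' ∩ Q.erase b ≠ {a}} (by
      rintro a ⟨e, he⟩
      by_cases hex : ∃ e', b ∈ E e' ∧ E e' ∩ Q.erase b = {a}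
      · obtain ⟨e', hbe', he'⟩ := hex
        exact ⟨e', fun a' _ hbn => absurd hbe' hbn, he'⟩
      · push Not at hex
        have hbe : b ∉ E e := fun hbe => hex e hbe he
        obtain ⟨t, htS, hta⟩ := hS a ⟨e, by rw [hsame e hbe, he]⟩
        have hbt : b ∉ E t := fun hbt => by
          have h1 : b ∈ E t ∩ Q := Finset.mem_inter.2 ⟨hbt, hbQ⟩
          rw [hta, Finset.mem_singleton] at h1
          have h2 : a ∈ E e ∩ Q.erase b := by simp [he]
          simp [h1] at h2
        have hta' : E t ∩ Q.erase b = {a} := by rw [← hsame t hbt, hta]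
        refine ⟨t, fun a' ha' _ => ⟨htS, ?_⟩, hta'⟩
        have : a = a' := Finset.singleton_injective (hta'.symm.trans ha')
        exact this ▸ hex)
    have hi := h.exists_insert (S := S) hM hlin (Finset.notMem_erase b Q) hsS
      (by rwa [Finset.insert_erase hbQ]) (fun e he => he)
    rw [Finset.insert_erase hbQ] at hi
    obtain ⟨f', lo', h'⟩ := hi
    exact ⟨N, f', lo', h', fun hcl => absurd he₀ (hcl e₀)⟩

end LinearHypergraph


/-- For every linear hypergraph `H` (vertex type `V`, edges given by the
family `E : ι → Finset V`, multiple edges allowed via the index type) in which every edge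
has size at least `2` and at most `r` (where `r ≥ 2`), and in which no edge consists of
twins (vertices contained in exactly the same edges), there is an edge weighting
`ω : ι → {1, …, max 5 (r+1)}` such that the induced vertex weights
`ω(v) = ∑_{e ∋ v} ω(e)` properly color `V`: every edge contains two vertices with
different induced weights. -/
theorem vertex_coloring_weighting_of_linear {V ι : Type*} [Fintype V] [Fintype ι]
    [DecidableEq V] (r : ℕ) (hr : 2 ≤ r) (E : ι → Finset V)
    (hsize : ∀ i, 2 ≤ (E i).card ∧ (E i).card ≤ r)
    (hlinear : ∀ i j, i ≠ j → (E i ∩ E j).card ≤ 1)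
    (htwins : ∀ i, ¬ (∀ u ∈ E i, ∀ v ∈ E i, ∀ j, (u ∈ E j ↔ v ∈ E j))) :
    ∃ ω : ι → ℕ, (∀ i, 1 ≤ ω i ∧ ω i ≤ max 5 (r + 1)) ∧
      ∀ i, ∃ u ∈ E i, ∃ v ∈ E i,
        (∑ j, if u ∈ E j then ω j else 0) ≠ (∑ j, if v ∈ E j then ω j else 0) := by
  obtain ⟨N, f, lo, h, hN⟩ := exists_adaptedWeighting (E := E) (M := ((max 5 (r + 1) : ℕ) : ℤ))
    (by exact_mod_cast le_max_left _ _) hlinear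
    (fun e => by exact_mod_cast lt_of_lt_of_le (Nat.lt_succ_of_le (hsize e).2) (le_max_right _ _))
    Finset.univ Set.univ (fun a ⟨e, he⟩ => ⟨e, trivial, he⟩)
  have hNuniv := hN fun e => by
    have := (hsize e).1
    rw [Finset.inter_univ]
    omega
  have hbd := h.bounds
  have hcast : ∀ v, ((∑ j, if v ∈ E j then (f j).toNat else 0 : ℕ) : ℤ) = inducedWeight E f v := by
    intro v
    unfold inducedWeight
    push_cast
    refine Finset.sum_congr rfl fun j _ => ?_
    have := (hbd j).1
    split_ifs <;> omega
  refine ⟨fun i => (f i).toNat, fun i => ?_, fun i => ?_⟩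
  · obtain ⟨h1, h2⟩ := hbd i
    exact ⟨Int.toNat_le_toNat h1, Int.toNat_le.2 h2⟩
  suffices ∃ u ∈ E i, ∃ v ∈ E i, inducedWeight E f u ≠ inducedWeight E f v by
    obtain ⟨u, hu, v, hv, huv⟩ := this
    refine ⟨u, hu, v, hv, fun heq => huv ?_⟩
    rw [← hcast, ← hcast]
    exact congrArg _ heq
  have hi0 : 0 < (E i).card := by
    have := (hsize i).1
    omega
  by_cases hdeg : ∀ u ∈ E i, ∃ j, j ≠ i ∧ u ∈ E j
  · obtain ⟨u, hu, v, hv, huv⟩ := h.final i hdeg (by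
      rw [hNuniv, Finset.inter_univ]
      exact Finset.card_pos.1 hi0)
    exact ⟨u, (Finset.mem_inter.1 hu).1, v, (Finset.mem_inter.1 hv).1, huv⟩
  · -- a vertex of degree one and a vertex of larger degree
    push Not at hdeg
    obtain ⟨u, hu, hu1⟩ := hdeg
    have hw : ∃ v ∈ E i, ∃ j, j ≠ i ∧ v ∈ E j := by
      by_contra hno
      push Not at hno
      refine htwins i fun x hx y hy j => ?_
      by_cases hj : j = i
      · subst hj
        simp [hx, hy]
      · simp [hno x hx j hj, hno y hy j hj]
    obtain ⟨v, hv, j, hj, hvj⟩ := hw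
    refine ⟨u, hu, v, hv, ne_of_lt ?_⟩
    unfold inducedWeight
    refine Finset.sum_lt_sum (fun k _ => ?_) ⟨j, Finset.mem_univ j, ?_⟩
    · have := (hbd k).1
      by_cases hk : k = i
      · subst hk
        simp [hu, hv]
      · rw [if_neg (hu1 k hk)]
        split_ifs <;> omega
    · have := (hbd j).1
      rw [if_neg (hu1 j hj), if_pos hvj]
      omega
end

section
/- For every linear hypergraph H in which every edge has size at least 2 and at most r (where r ≥ 2) and which has no isolated edges, and for every vertex pre-weighting ω' : V(H) → ℕ, there exists an edge weighting ω : E(H) → {1, 2, ..., max(5, r+1)} such that the induced vertex weights ω(v) = ω'(v) + Σ_{e ∈ E(H), v ∈ e} ω(e) properly color V(H), i.e., every edge of H contains at least two vertices with different induced weights. -/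
namespace LinearHypergraph

variable {V ι : Type*} [DecidableEq V]

/-- The weight induced at `v` by the pre-weighting `c` and the edge weighting `ω`. -/
def wt [Fintype ι] (E : ι → Finset V) (c : V → ℤ) (ω : ι → ℤ) (v : V) : ℤ :=
  c v + ∑ i, if v ∈ E i then ω i else 0

/-- The edge `E i` is not monochromatic. -/
def Proper [Fintype ι] (E : ι → Finset V) (c : V → ℤ) (ω : ι → ℤ) (i : ι) : Prop :=
  ∃ u ∈ E i, ∃ v ∈ E i, wt E c ω u ≠ wt E c ω v

lemma eq_of_mem_of_mem [DecidableEq ι]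
    {E : ι → Finset V} (hlin : ∀ i j, i ≠ j → (E i ∩ E j).card ≤ 1)
    {i j : ι} {u v : V} (huv : u ≠ v) (hui : u ∈ E i) (hvi : v ∈ E i) (huj : u ∈ E j)
    (hvj : v ∈ E j) : i = j := by
  by_contra hij
  exact huv (Finset.card_le_one.1 (hlin i j hij) u (by simp [*]) v (by simp [*]))

lemma wt_congr [Fintype ι] {E : ι → Finset V} {c : V → ℤ} {ω ω' : ι → ℤ} {v : V}
    (h : ∀ i, v ∈ E i → ω i = ω' i) : wt E c ω v = wt E c ω' v := by
  unfold wt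
  congr 1
  refine Finset.sum_congr rfl fun i _ => ?_
  split_ifs with hv
  · exact h i hv
  · rfl

lemma wt_sub [Fintype ι] (E : ι → Finset V) (c : V → ℤ) (ω ω' : ι → ℤ) (v : V) :
    wt E c ω' v = wt E c ω v + ∑ i, if v ∈ E i then ω' i - ω i else 0 := by
  unfold wt
  rw [add_assoc, ← Finset.sum_add_distrib]
  congr 1
  refine Finset.sum_congr rfl fun i _ => ?_
  split_ifs <;> ring

lemma wt_update [Fintype V] [Fintype ι] [DecidableEq ι]
    (E : ι → Finset V) (c : V → ℤ) (ω : ι → ℤ) (j : ι) (x : ℤ) (v : V) :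
    wt E c (Function.update ω j x) v = wt E c ω v + if v ∈ E j then x - ω j else 0 := by
  rw [wt_sub E c ω, Finset.sum_eq_single j]
  · simp
  · intro i _ hi
    simp [Function.update_of_ne hi]
  · simp

/-- A single edge can be reweighted so as to separate fewer than `k` prescribed pairs, each of
which it meets in exactly one vertex. -/
lemma exists_update [Fintype V] [Fintype ι] [DecidableEq ι]
    (E : ι → Finset V) (c : V → ℤ) (ω : ι → ℤ) (j : ι) (k : ℕ) (C : Finset ι)
    (hC : C.card < k) (p q : ι → V) (h : ∀ i ∈ C, p i ∈ E j ∧ q i ∉ E j) :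
    ∃ x : ℤ, 1 ≤ x ∧ x ≤ k ∧ ∀ i ∈ C,
      wt E c (Function.update ω j x) (p i) ≠ wt E c (Function.update ω j x) (q i) := by
  obtain ⟨x, hx, hxC⟩ := Finset.exists_mem_notMem_of_card_lt_card
    (s := C.image fun i => wt E c ω (q i) - wt E c ω (p i) + ω j) (t := Finset.Icc (1 : ℤ) k)
    (Finset.card_image_le.trans_lt (by simpa using hC))
  rw [Finset.mem_Icc] at hx
  refine ⟨x, hx.1, hx.2, fun i hi heq => hxC (Finset.mem_image.2 ⟨i, hi, ?_⟩)⟩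
  rw [wt_update, wt_update, if_pos (h i hi).1, if_neg (h i hi).2] at heq
  linarith

/-- Removing vertices from `v` on, one at a time, as long as some edge has a single vertex left. -/
lemma exists_peeling [Fintype V] (E : ι → Finset V) (v : V) :
    ∃ (Z : Finset V) (ρ : V → ℕ), v ∈ Z ∧ Set.InjOn ρ Z ∧ (∀ z ∈ Z, ρ z ≤ ρ v) ∧
      (∀ i, 2 ≤ (E i).card → (E i \ Z).card ≠ 1) ∧
      ∀ z ∈ Z, z ≠ v → ∃ i, z ∈ E i ∧ E i ⊆ Z ∧ 2 ≤ (E i).card ∧ ∀ x ∈ E i, ρ z ≤ ρ x := by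
  let Q : Finset V → Prop := fun Z => ∃ ρ : V → ℕ, v ∈ Z ∧ Set.InjOn ρ Z ∧
    (∀ z ∈ Z, ρ z ≤ ρ v) ∧
    ∀ z ∈ Z, z ≠ v → ∃ i, z ∈ E i ∧ E i ⊆ Z ∧ 2 ≤ (E i).card ∧ ∀ x ∈ E i, ρ z ≤ ρ x
  have hQ : Q {v} := ⟨fun _ => 0, by simp, by simp, by simp, by simp⟩
  obtain ⟨Z, hZ, hmax⟩ := (Set.toFinite {Z | Q Z}).exists_maximal ⟨_, hQ⟩
  obtain ⟨ρ, hv, hinj, hle, hfwd⟩ := hZ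
  refine ⟨Z, ρ, hv, hinj, hle, fun i hi h1 => ?_, hfwd⟩
  obtain ⟨z, hz⟩ := Finset.card_eq_one.1 h1
  have hz' : z ∈ E i \ Z := by simp [hz]
  rw [Finset.mem_sdiff] at hz'
  have hsub : E i ⊆ insert z Z := fun x hx => by
    by_cases hxZ : x ∈ Z
    · simp [hxZ]
    · have : x ∈ E i \ Z := by simp [hx, hxZ]
      rw [hz, Finset.mem_singleton] at this
      simp [this]
  have hne : ∀ x ∈ Z, x ≠ z := fun x hx h => hz'.2 (h ▸ hx)
  have hext : Q (insert z Z) := by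
    refine ⟨fun x => if x = z then 0 else ρ x + 1, by simp [hv], ?_, ?_, ?_⟩
    · intro a ha b hb hab
      simp only [Finset.coe_insert, Set.mem_insert_iff, Finset.mem_coe] at ha hb
      dsimp only at hab
      split_ifs at hab with h1 h2 h2
      · rw [h1, h2]
      · exact hinj (ha.resolve_left h1) (hb.resolve_left h2) (by omega)
    · intro x hx
      have := hne v hv
      simp only [if_neg this]
      split_ifs with h
      · omega
      · have := hle x ((Finset.mem_insert.1 hx).resolve_left h)
        omega
    · intro x hx hxv
      by_cases h : x = z
      · subst h
        exact ⟨i, hz'.1, hsub, hi, by simp⟩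
      · obtain ⟨e, he, heZ, he2, hρ⟩ := hfwd x ((Finset.mem_insert.1 hx).resolve_left h) hxv
        refine ⟨e, he, heZ.trans (Finset.subset_insert _ _), he2, fun u hu => ?_⟩
        have := hρ u hu
        simp only [if_neg h, if_neg (hne u (heZ hu))]
        omega
  exact hz'.2 (hmax hext (Finset.subset_insert _ _) (Finset.mem_insert_self _ _))

/-- The choice of toggles at a generic vertex: some reachable pair `{w, w + 2}` avoids the pairs of
all backward neighbours. -/
lemma exists_toggle (B : Finset ι) (w : ι → ℤ) (a : ℤ) :
    ∃ U ⊆ B, ∃ x ε : ℤ, (x % 4 = 0 ∨ x % 4 = 1) ∧ (∀ i ∈ B, w i ≠ x) ∧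
      (ε = 0 ∧ (a + 2 * U.card + ε = x ∨ a + 2 * U.card + ε = x + 2) ∨
        ε = -1 ∧ a + 2 * U.card + ε = x) := by
  let τ : ℕ → ℤ := fun j => (a + 2 * j) - ((a + 2 * j) % 4 + 1) / 2
  obtain ⟨x, hx, hxB⟩ := Finset.exists_mem_notMem_of_card_lt_card
    (s := B.image w) (t := (Finset.range (B.card + 1)).image τ) (by
      refine Finset.card_image_le.trans_lt ?_
      rw [Finset.card_image_of_injective]
      · simp
      · intro i j hij
        simp only [τ] at hij
        omega)
  obtain ⟨j, hj, rfl⟩ := Finset.mem_image.1 hx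
  rw [Finset.mem_range] at hj
  obtain ⟨U, hU, rfl⟩ := Finset.exists_subset_card_eq (show j ≤ B.card by omega)
  have hne : ∀ i ∈ B, w i ≠ τ U.card := fun i hi h => hxB (Finset.mem_image.2 ⟨i, hi, h⟩)
  refine ⟨U, hU, τ U.card, if (a + 2 * U.card) % 4 = 0 ∨ (a + 2 * U.card) % 4 = 3 then 0 else -1,
    ?_, hne, ?_⟩
  · simp only [τ]
    omega
  · simp only [τ]
    split_ifs <;> omega

/-- The choice of toggles at the last vertex. -/
lemma exists_final_toggle [DecidableEq ι] (B : Finset ι) (w : ι → ℤ) (a : ℤ) (hB : 2 ≤ B.card)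
    (hw : ∀ i ∈ B, w i % 4 = 0 ∨ w i % 4 = 1) :
    ∃ U ⊆ B, ∀ i ∈ B, a + 2 * (U.card : ℤ) ≠ w i + if i ∈ U then 2 else 0 := by
  by_cases h0 : ∀ i ∈ B, a ≠ w i
  · exact ⟨∅, by simp, by simpa using h0⟩
  push Not at h0
  obtain ⟨i₀, hi₀, h0⟩ := h0
  by_cases h1 : ∃ i ∈ B, w i ≠ a
  · obtain ⟨i₁, hi₁, h1⟩ := h1
    refine ⟨{i₁}, by simpa using hi₁, fun i hi => ?_⟩
    have := hw i hi
    have := hw i₀ hi₀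
    simp only [Finset.card_singleton, Finset.mem_singleton]
    split_ifs with h
    · subst h
      push_cast
      omega
    · push_cast
      omega
  · push Not at h1
    obtain ⟨U, hU, hc⟩ := Finset.exists_subset_card_eq hB
    refine ⟨U, hU, fun i hi => ?_⟩
    rw [hc, h1 i hi]
    split_ifs <;> push_cast <;> omega

/-- The vertex `p` is the only vertex of `E i` placed before time `t`. -/
def Half (E : ι → Finset V) (ρ : V → ℕ) (t : ℕ) (i : ι) (p : V) : Prop :=
  p ∈ E i ∧ ρ p < t ∧ ∀ q ∈ E i, q ≠ p → t ≤ ρ q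

/-- Invariant of the greedy procedure: each vertex `p` placed before time `t` has been promised a
weight in `{w p, w p + 2}`, edges with two placed vertices are settled, edges with one placed
vertex can be toggled, and the other edges have weight `3`. -/
structure Invariant [Fintype ι]
    (E : ι → Finset V) (S : Finset ι) (Z : Finset V) (ρ : V → ℕ) (g : V → ι)
    (c : V → ℤ) (t : ℕ) (w : V → ℤ) (ω : ι → ℤ) : Prop where
  promised : ∀ p ∈ Z, ρ p < t →
    (w p % 4 = 0 ∨ w p % 4 = 1) ∧ (wt E c ω p = w p ∨ wt E c ω p = w p + 2)
  settled : ∀ i ∈ S, ∀ p ∈ E i, ∀ q ∈ E i, p ≠ q → ρ p < t → ρ q < t →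
    (1 ≤ ω i ∧ ω i ≤ 5) ∧ ∃ u ∈ E i, ∃ v ∈ E i, ρ u < t ∧ ρ v < t ∧ w u ≠ w v
  half : ∀ i ∈ S, ∀ p, Half E ρ t i p → ω i = 3 ∨ i = g p ∧ ω i = 2 ∧ wt E c ω p = w p
  untouched : ∀ i ∈ S, (∀ q ∈ E i, t ≤ ρ q) → ω i = 3

/-- Switch the state of the placed vertex `p i` of every edge `i ∈ B`, so that it becomes upper
exactly when `i ∈ U`, and add `ε` to the edge `e`. -/
def toggle [Fintype ι] [DecidableEq ι]
    (E : ι → Finset V) (c : V → ℤ) (w : V → ℤ) (ω : ι → ℤ) (B U : Finset ι) (p : ι → V)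
    (e : ι) (ε : ℤ) (i : ι) : ℤ :=
  ω i + ((if i ∈ B then w (p i) + (if i ∈ U then 2 else 0) - wt E c ω (p i) else 0) +
    if i = e then ε else 0)

section Toggle

variable {E : ι → Finset V} {S : Finset ι} {ρ : V → ℕ} {c : V → ℤ} {t : ℕ} {w : V → ℤ} {ω : ι → ℤ}
  {z : V} {B U : Finset ι} {p : ι → V} {e : ι} {ε : ℤ}

lemma toggle_of_notMem [Fintype ι] [DecidableEq ι] {i : ι} (hi : i ∉ B) (he : i = e → ε = 0) :
    toggle E c w ω B U p e ε i = ω i := by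
  unfold toggle
  rw [if_neg hi]
  split_ifs with h
  · simp [he h]
  · simp

lemma wt_toggle_self [Fintype V] [Fintype ι] [DecidableEq ι]
    (hz : ∀ i ∈ B, z ∈ E i) (he : ε ≠ 0 → z ∈ E e) (hU : U ⊆ B) :
    wt E c (toggle E c w ω B U p e ε) z =
      wt E c ω z + ∑ i ∈ B, (w (p i) - wt E c ω (p i)) + 2 * U.card + ε := by
  have h : ∀ i, (if z ∈ E i then toggle E c w ω B U p e ε i - ω i else 0) =
      (if i ∈ B then w (p i) - wt E c ω (p i) else 0) + (if i ∈ U then 2 else 0) +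
        if i = e then ε else 0 := by
    intro i
    unfold toggle
    by_cases hi : i ∈ B
    · rw [if_pos (hz i hi), if_pos hi, if_pos hi]
      ring
    · rw [if_neg hi, if_neg hi, if_neg fun h => hi (hU h)]
      by_cases hie : i = e
      · subst hie
        by_cases hε : ε = 0
        · simp [hε]
        · simp [he hε]
      · simp [hie]
  rw [wt_sub E c ω, Finset.sum_congr rfl fun i _ => h i, Finset.sum_add_distrib,
    Finset.sum_add_distrib]
  simp only [Finset.sum_ite_mem, Finset.univ_inter, Finset.sum_const, Finset.sum_ite_eq',
    Finset.mem_univ, if_true, nsmul_eq_mul]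
  ring

lemma wt_toggle_of_notMem [Fintype V] [Fintype ι] [DecidableEq ι]
    {q : V} (hB : ∀ i ∈ B, q ∉ E i) (he : ε ≠ 0 → q ∉ E e) :
    wt E c (toggle E c w ω B U p e ε) q = wt E c ω q := by
  refine wt_congr fun i hi => toggle_of_notMem (fun h => hB i h hi) fun h => ?_
  by_contra hε
  exact he hε (h ▸ hi)

lemma wt_toggle_of_mem [Fintype V] [Fintype ι] [DecidableEq ι]
    {i : ι} (hi : i ∈ B) (hpi : p i ∈ E i) (hB : ∀ j ∈ B, p i ∈ E j → j = i)
    (he : ε ≠ 0 → p i ∉ E e) :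
    wt E c (toggle E c w ω B U p e ε) (p i) = w (p i) + if i ∈ U then 2 else 0 := by
  have hz : ∀ j, j = e → p i ∈ E j → ε = 0 := by
    rintro j rfl hj
    by_contra hε
    exact he hε hj
  rw [wt_sub E c ω, Finset.sum_eq_single i]
  · rw [if_pos hpi]
    unfold toggle
    rw [if_pos hi]
    split_ifs with _ h h
    · rw [hz i h hpi]; ring
    · ring
    · rw [hz i h hpi]; ring
    · ring
  · intro j _ hji
    split_ifs with hj
    · rw [toggle_of_notMem (fun h => hji (hB j h hj)) fun h => hz j h hj, sub_self]
    · rfl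
  · simp

end Toggle

section Greedy

variable {E : ι → Finset V} {S : Finset ι} {Z : Finset V} {ρ : V → ℕ} {g : V → ι} {c : V → ℤ}
  {t : ℕ} {w : V → ℤ} {ω : ι → ℤ} {z : V} {B U : Finset ι} {p : ι → V} {e : ι} {ε : ℤ}

lemma Half.eq {i : ι} {p q : V} (h : Half E ρ t i p) (hq : q ∈ E i) (hqt : ρ q < t) : q = p := by
  by_contra hne
  have := h.2.2 q hq hne
  omega

/-- How a toggle changes the weight of a placed vertex. -/
lemma wt_toggle_placed [Fintype V] [Fintype ι] [DecidableEq ι]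
    (hlin : ∀ i j, i ≠ j → (E i ∩ E j).card ≤ 1) (hzt : ρ z = t)
    (hz : ∀ i ∈ B, z ∈ E i) (hp : ∀ i ∈ B, Half E ρ t i (p i))
    (he : ε ≠ 0 → ∀ q ∈ E e, t ≤ ρ q) {q : V} (hq : ρ q < t) :
    (∃ i ∈ B, p i = q ∧
      wt E c (toggle E c w ω B U p e ε) q = w q + if i ∈ U then 2 else 0) ∨
    (∀ i ∈ B, p i ≠ q) ∧ wt E c (toggle E c w ω B U p e ε) q = wt E c ω q := by
  have he' : ε ≠ 0 → q ∉ E e := fun hε hqe => by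
    have := he hε q hqe
    omega
  by_cases h : ∃ i ∈ B, p i = q
  · obtain ⟨i, hi, rfl⟩ := h
    have hne : p i ≠ z := fun h => by
      rw [h] at hq
      omega
    exact Or.inl ⟨i, hi, rfl, wt_toggle_of_mem hi (hp i hi).1
      (fun j hj hij => eq_of_mem_of_mem hlin hne hij (hz j hj) (hp i hi).1 (hz i hi)) he'⟩
  · push Not at h
    exact Or.inr ⟨h, wt_toggle_of_notMem
      (fun i hi hqi => h i hi ((hp i hi).eq hqi hq).symm) he'⟩

lemma toggle_mem_Icc [Fintype ι] [DecidableEq ι]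
    (hI : Invariant E S Z ρ g c t w ω) (hSZ : ∀ i ∈ S, E i ⊆ Z) {i : ι}
    (hiS : i ∈ S) (hi : i ∈ B) (hp : Half E ρ t i (p i)) (he : ε ≠ 0 → ∀ q ∈ E e, t ≤ ρ q) :
    1 ≤ toggle E c w ω B U p e ε i ∧ toggle E c w ω B U p e ε i ≤ 5 := by
  have h1 := (hI.promised (p i) (hSZ i hiS hp.1) hp.2.1).2
  have h2 := hI.half i hiS (p i) hp
  have h3 : (if i = e then ε else 0) = 0 := by
    split_ifs with h
    · by_contra hε
      have := he hε (p i) (h ▸ hp.1)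
      have := hp.2.1
      omega
    · rfl
  unfold toggle
  rw [h3, if_pos hi]
  split_ifs <;> omega

lemma Invariant.of_forall_ne [Fintype ι] (hI : Invariant E S Z ρ g c t w ω) (hSZ : ∀ i ∈ S, E i ⊆ Z)
    (h : ∀ z ∈ Z, ρ z ≠ t) : Invariant E S Z ρ g c (t + 1) w ω := by
  have hlt : ∀ z ∈ Z, ρ z < t + 1 → ρ z < t := fun z hz hzt => by
    have := h z hz
    omega
  refine ⟨fun p hp hpt => hI.promised p hp (hlt p hp hpt), fun i hi p hp q hq hpq hpt hqt => ?_,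
    fun i hi p hp => hI.half i hi p ⟨hp.1, hlt p (hSZ i hi hp.1) hp.2.1, fun q hq hqp => ?_⟩,
    fun i hi hq => hI.untouched i hi fun q hqi => ?_⟩
  · obtain ⟨h1, u, hu, v, hv, hut, hvt, hne⟩ := hI.settled i hi p hp q hq hpq
      (hlt p (hSZ i hi hp) hpt) (hlt q (hSZ i hi hq) hqt)
    exact ⟨h1, u, hu, v, hv, by omega, by omega, hne⟩
  · have := hp.2.2 q hq hqp
    omega
  · have := hq q hqi
    omega

lemma exists_half [Fintype V]
    (E : ι → Finset V) (S : Finset ι) (ρ : V → ℕ) (t : ℕ) (z : V) (d : V) :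
    ∃ (B : Finset ι) (p : ι → V), (∀ i, i ∈ B ↔ i ∈ S ∧ z ∈ E i ∧ ∃ q, Half E ρ t i q) ∧
      ∀ i ∈ B, Half E ρ t i (p i) := by
  classical
  refine ⟨S.filter fun i => z ∈ E i ∧ ∃ q, Half E ρ t i q,
    fun i => if h : ∃ q, Half E ρ t i q then h.choose else d, by simp, fun i hi => ?_⟩
  have h := (Finset.mem_filter.1 hi).2.2
  beta_reduce
  rw [dif_pos h]
  exact h.choose_spec

/-- One step of the greedy procedure. -/
lemma Invariant.step [Fintype V] [Fintype ι] [DecidableEq ι]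
    (hlin : ∀ i j, i ≠ j → (E i ∩ E j).card ≤ 1)
    (hI : Invariant E S Z ρ g c t w ω) (hSZ : ∀ i ∈ S, E i ⊆ Z) (hinj : Set.InjOn ρ Z)
    (hz : z ∈ Z) (hzt : ρ z = t)
    (hgz : g z ∈ S ∧ z ∈ E (g z) ∧ ∀ x ∈ E (g z), ρ z ≤ ρ x)
    (hmin : ∀ p ∈ Z, ρ p < t → ∀ j ∈ S, p ∈ E j → (∀ x ∈ E j, ρ p ≤ ρ x) →
      ∀ x' ∈ E j, x' ≠ p → ∃ x ∈ E (g p), x ≠ p ∧ ρ x ≤ ρ x') :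
    ∃ w' ω', (∀ i ∉ S, ω' i = ω i) ∧ Invariant E S Z ρ g c (t + 1) w' ω' := by
  obtain ⟨B, p, hB, hp⟩ := exists_half E S ρ t z z
  have hzB : ∀ i ∈ B, z ∈ E i := fun i hi => ((hB i).1 hi).2.1
  obtain ⟨U, hU, x, ε, hx, hxB, hε⟩ := exists_toggle B (fun i => w (p i))
    (wt E c ω z + ∑ i ∈ B, (w (p i) - wt E c ω (p i)))
  have he : ε ≠ 0 → ∀ q ∈ E (g z), t ≤ ρ q := fun _ q hq => hzt ▸ hgz.2.2 q hq
  have hself := wt_toggle_self (c := c) (w := w) (ω := ω) (p := p) hzB (fun _ : ε ≠ 0 => hgz.2.1) hU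
  have hplaced := fun q (hq : ρ q < t) => wt_toggle_placed (c := c) (w := w) (ω := ω) (U := U)
    hlin hzt hzB hp he hq
  set ω' := toggle E c w ω B U p (g z) ε with hω'
  have hlt : ∀ q ∈ Z, q ≠ z → ρ q < t + 1 → ρ q < t := fun q hq hqz hqt => by
    have : ρ q ≠ ρ z := fun h => hqz (hinj hq hz h)
    omega
  have hnez : ∀ q, ρ q < t → q ≠ z := by
    rintro q hq rfl
    omega
  have hsame : ∀ i, i ∉ B → (∃ q ∈ E i, ρ q < t) → ω' i = ω i := by
    rintro i hi ⟨q, hq, hqt⟩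
    refine toggle_of_notMem hi fun h => ?_
    by_contra hε
    have := he hε q (h ▸ hq)
    omega
  refine ⟨Function.update w z x, ω', fun i hi => ?_, ?_, ?_, ?_, ?_⟩
  · exact toggle_of_notMem (fun h => hi ((hB i).1 h).1) fun h => absurd (h ▸ hgz.1) hi
  · intro q hq hqt
    by_cases hqz : q = z
    · subst hqz
      rw [Function.update_self, hself]
      exact ⟨hx, by omega⟩
    · have hqt' := hlt q hq hqz hqt
      obtain ⟨h1, h2⟩ := hI.promised q hq hqt'
      rw [Function.update_of_ne hqz]
      refine ⟨h1, ?_⟩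
      obtain ⟨i, -, -, h⟩ | ⟨-, h⟩ := hplaced q hqt'
      · rw [h]
        split_ifs <;> simp
      · rwa [h]
  · intro i hi a ha b hb hab hat hbt
    obtain ⟨q, hq, hqt⟩ : ∃ q ∈ E i, ρ q < t := by
      by_cases haz : a = z
      · exact ⟨b, hb, hlt b (hSZ i hi hb) (fun h => hab (haz.trans h.symm)) hbt⟩
      · exact ⟨a, ha, hlt a (hSZ i hi ha) haz hat⟩
    by_cases h : ∃ q' ∈ E i, q' ≠ q ∧ ρ q' < t
    · obtain ⟨q', hq', hqq, hqt'⟩ := h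
      obtain ⟨h1, u, hu, v, hv, hut, hvt, hne⟩ := hI.settled i hi q' hq' q hq hqq hqt' hqt
      rw [hsame i (fun h => hqq (((hp i h).eq hq' hqt').trans ((hp i h).eq hq hqt).symm))
        ⟨q, hq, hqt⟩]
      refine ⟨h1, u, hu, v, hv, by omega, by omega, ?_⟩
      rwa [Function.update_of_ne (hnez u hut), Function.update_of_ne (hnez v hvt)]
    · push Not at h
      have hzi : z ∈ E i := by
        by_cases haz : a = z
        · exact haz ▸ ha
        by_cases hbz : b = z
        · exact hbz ▸ hb
        have h1 := hlt a (hSZ i hi ha) haz hat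
        have h2 := hlt b (hSZ i hi hb) hbz hbt
        by_cases haq : a = q
        · have := h b hb fun hbq => hab (haq.trans hbq.symm)
          omega
        · have := h a ha haq
          omega
      have hiB : i ∈ B := (hB i).2 ⟨hi, hzi, q, hq, hqt, h⟩
      have hpi := (hp i hiB).eq hq hqt
      refine ⟨toggle_mem_Icc hI hSZ hi hiB (hp i hiB) he, q, hq, z, hzi, by omega, by omega, ?_⟩
      rw [Function.update_self, Function.update_of_ne (hnez q hqt), hpi]
      exact hxB i hiB
  · intro i hi q hq
    by_cases hqz : q = z
    · subst hqz
      have hall : ∀ y ∈ E i, t ≤ ρ y := fun y hy => by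
        by_cases hyq : y = q
        · rw [hyq, hzt]
        · have := hq.2.2 y hy hyq
          omega
      have hiB : i ∉ B := fun h => by
        have h1 := hall _ (hp i h).1
        have h2 := (hp i h).2.1
        omega
      have h3 := hI.untouched i hi hall
      by_cases hε0 : i = g q → ε = 0
      · left
        rw [hω', toggle_of_notMem hiB hε0, h3]
      · push Not at hε0
        obtain ⟨hig, hε0⟩ := hε0
        right
        rw [Function.update_self, hself]
        refine ⟨hig, ?_, by omega⟩
        rw [hω', toggle, if_neg hiB, if_pos hig]
        omega
    · have hqt := hlt q (hSZ i hi hq.1) hqz hq.2.1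
      have hzi : z ∉ E i := fun h => by
        have := hq.2.2 z h (Ne.symm hqz)
        omega
      rw [hsame i (fun h => hzi (hzB i h)) ⟨q, hq.1, hqt⟩, Function.update_of_ne hqz]
      obtain h3 | ⟨hig, h2, hw⟩ := hI.half i hi q ⟨hq.1, hqt, fun y hy hyq => by
        have := hq.2.2 y hy hyq
        omega⟩
      · exact Or.inl h3
      · refine Or.inr ⟨hig, h2, ?_⟩
        obtain ⟨j, hj, hjq, -⟩ | ⟨-, h⟩ := hplaced q hqt
        · exfalso
          have hpj := hp j hj
          rw [hjq] at hpj
          obtain ⟨y, hy, hyq, hyz⟩ := hmin q (hSZ i hi hq.1) hqt j ((hB j).1 hj).1 hpj.1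
            (fun y hy => by
              by_cases hyq : y = q
              · rw [hyq]
              · have := hpj.2.2 y hy hyq
                omega) z (hzB j hj) (Ne.symm hqz)
          have := hq.2.2 y (hig ▸ hy) hyq
          omega
        · rw [h, hw]
  · intro i hi hall
    have hzi : z ∉ E i := fun h => by
      have := hall z h
      omega
    rw [hω', toggle_of_notMem (fun h => hzi (hzB i h)) fun h => absurd (h ▸ hgz.2.1) hzi]
    exact hI.untouched i hi fun q hq => by
      have := hall q hq
      omega

/-- The last step of the greedy procedure. -/
lemma Invariant.finish [Fintype V] [Fintype ι] [DecidableEq ι]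
    (hlin : ∀ i j, i ≠ j → (E i ∩ E j).card ≤ 1) {v : V}
    (hI : Invariant E S Z ρ g c (ρ v) w ω) (hSZ : ∀ i ∈ S, E i ⊆ Z) (hS : ∀ i ∈ S, 2 ≤ (E i).card)
    (hinj : Set.InjOn ρ Z) (hv : v ∈ Z) (hlast : ∀ z ∈ Z, ρ z ≤ ρ v)
    {i₁ i₂ : ι} (hne : i₁ ≠ i₂) (h₁ : i₁ ∈ S ∧ (E i₁).card = 2 ∧ v ∈ E i₁)
    (h₂ : i₂ ∈ S ∧ (E i₂).card = 2 ∧ v ∈ E i₂) :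
    ∃ ω', (∀ i ∉ S, ω' i = ω i) ∧ ∀ i ∈ S, (1 ≤ ω' i ∧ ω' i ≤ 5) ∧ Proper E c ω' i := by
  have hlt : ∀ q ∈ Z, q ≠ v → ρ q < ρ v := fun q hq hqv =>
    lt_of_le_of_ne (hlast q hq) fun h => hqv (hinj hq hv h)
  obtain ⟨B, p, hB, hp⟩ := exists_half E S ρ (ρ v) v v
  have hvB : ∀ i ∈ B, v ∈ E i := fun i hi => ((hB i).1 hi).2.1
  have hmem : ∀ i, i ∈ S ∧ (E i).card = 2 ∧ v ∈ E i → i ∈ B := by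
    rintro i ⟨hi, h2, hvi⟩
    obtain ⟨q, hq, hqv⟩ := Finset.exists_mem_ne (by omega : 1 < (E i).card) v
    refine (hB i).2 ⟨hi, hvi, q, hq, hlt q (hSZ i hi hq) hqv, fun y hy hyq => ?_⟩
    have hEq : {q, v} = E i := Finset.eq_of_subset_of_card_le
      (by simp [Finset.insert_subset_iff, hq, hvi]) (by rw [Finset.card_pair hqv, h2])
    rw [← hEq, Finset.mem_insert, Finset.mem_singleton] at hy
    rw [hy.resolve_left hyq]
  have hcard : 2 ≤ B.card := Finset.one_lt_card.2 ⟨i₁, hmem i₁ h₁, i₂, hmem i₂ h₂, hne⟩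
  obtain ⟨U, hU, hfin⟩ := exists_final_toggle B (fun i => w (p i))
    (wt E c ω v + ∑ i ∈ B, (w (p i) - wt E c ω (p i))) hcard fun i hi =>
      (hI.promised (p i) (hSZ i ((hB i).1 hi).1 (hp i hi).1) (hp i hi).2.1).1
  have he : (0 : ℤ) ≠ 0 → ∀ q ∈ E i₁, ρ v ≤ ρ q := fun h => absurd rfl h
  have hself := wt_toggle_self (c := c) (w := w) (ω := ω) (p := p) (e := i₁) hvB
    (fun h : (0 : ℤ) ≠ 0 => absurd rfl h) hU
  have hplaced := fun q (hq : ρ q < ρ v) => wt_toggle_placed (c := c) (w := w) (ω := ω) (U := U)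
    hlin rfl hvB hp he hq
  refine ⟨toggle E c w ω B U p i₁ 0, fun i hi =>
    toggle_of_notMem (fun h => hi ((hB i).1 h).1) fun _ => rfl, fun i hi => ?_⟩
  obtain ⟨q, hq, hqv⟩ := Finset.exists_mem_ne (by have := hS i hi; omega : 1 < (E i).card) v
  have hqt := hlt q (hSZ i hi hq) hqv
  by_cases hiB : i ∈ B
  · refine ⟨toggle_mem_Icc hI hSZ hi hiB (hp i hiB) he, v, hvB i hiB, p i, (hp i hiB).1, ?_⟩
    have hpi := (hp i hiB).2.1
    rw [hself]
    obtain ⟨j, hj, hji, h⟩ | ⟨h, -⟩ := hplaced (p i) hpi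
    · have hji' : j = i := eq_of_mem_of_mem hlin (u := p i) (v := v)
        (fun h => by rw [h] at hpi; omega) (hji ▸ (hp j hj).1) (hvB j hj) (hp i hiB).1 (hvB i hiB)
      subst hji'
      rw [h]
      simpa using hfin j hj
    · exact absurd rfl (h i hiB)
  · obtain ⟨q', hq', hqq, hqt'⟩ : ∃ q' ∈ E i, q' ≠ q ∧ ρ q' < ρ v := by
      by_contra h
      push Not at h
      by_cases hvi : v ∈ E i
      · exact hiB ((hB i).2 ⟨hi, hvi, q, hq, hqt, h⟩)
      · obtain ⟨y, hy, hyq⟩ := Finset.exists_mem_ne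
          (by have := hS i hi; omega : 1 < (E i).card) q
        have h1 := h y hy hyq
        have h2 := hlt y (hSZ i hi hy) fun h => hvi (h ▸ hy)
        omega
    obtain ⟨h1, a, ha, b, hb, hat, hbt, hab⟩ := hI.settled i hi q' hq' q hq hqq hqt' hqt
    rw [toggle_of_notMem hiB fun _ => rfl]
    refine ⟨h1, a, ha, b, hb, ?_⟩
    have key : ∀ y ∈ E i, ρ y < ρ v → (w y % 4 = 0 ∨ w y % 4 = 1) ∧
        (wt E c (toggle E c w ω B U p i₁ 0) y = w y ∨
          wt E c (toggle E c w ω B U p i₁ 0) y = w y + 2) := by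
      intro y hy hyt
      obtain ⟨h1, h2⟩ := hI.promised y (hSZ i hi hy) hyt
      refine ⟨h1, ?_⟩
      obtain ⟨i, -, -, h⟩ | ⟨-, h⟩ := hplaced y hyt
      · rw [h]
        split_ifs <;> simp
      · rwa [h]
    have ka := key a ha hat
    have kb := key b hb hbt
    omega

/-- The greedy procedure along an ordering in which every vertex but the last one is the first
vertex of some edge, and the last one lies in two edges of size two. -/
lemma exists_greedy [Fintype V] [Fintype ι] [DecidableEq ι]
    (hlin : ∀ i j, i ≠ j → (E i ∩ E j).card ≤ 1) {v : V}
    (hSZ : ∀ i ∈ S, E i ⊆ Z) (hS : ∀ i ∈ S, 2 ≤ (E i).card)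
    (hinj : Set.InjOn ρ Z) (hv : v ∈ Z) (hlast : ∀ z ∈ Z, ρ z ≤ ρ v)
    (hfwd : ∀ z ∈ Z, z ≠ v → ∃ i ∈ S, z ∈ E i ∧ ∀ x ∈ E i, ρ z ≤ ρ x)
    {i₁ i₂ : ι} (hne : i₁ ≠ i₂) (h₁ : i₁ ∈ S ∧ (E i₁).card = 2 ∧ v ∈ E i₁)
    (h₂ : i₂ ∈ S ∧ (E i₂).card = 2 ∧ v ∈ E i₂) (c : V → ℤ) (ω₀ : ι → ℤ) :
    ∃ ω, (∀ i ∉ S, ω i = ω₀ i) ∧ ∀ i ∈ S, (1 ≤ ω i ∧ ω i ≤ 5) ∧ Proper E c ω i := by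
  have hg : ∀ z, ∃ e, z ∈ Z → z ≠ v → (e ∈ S ∧ z ∈ E e ∧ ∀ x ∈ E e, ρ z ≤ ρ x) ∧
      ∀ j ∈ S, z ∈ E j → (∀ x ∈ E j, ρ z ≤ ρ x) → ∀ x' ∈ E j, x' ≠ z →
        ∃ x ∈ E e, x ≠ z ∧ ρ x ≤ ρ x' := by
    intro z
    by_cases h : z ∈ Z ∧ z ≠ v
    swap
    · exact ⟨i₁, fun h1 h2 => absurd ⟨h1, h2⟩ h⟩
    obtain ⟨i, hi, hzi, hmin⟩ := hfwd z h.1 h.2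
    obtain ⟨y, hy, hyz⟩ := Finset.exists_mem_ne (by have := hS i hi; omega : 1 < (E i).card) z
    obtain ⟨x, hx, hxmin⟩ := Set.exists_min_image
      {x | ∃ e, (e ∈ S ∧ z ∈ E e ∧ ∀ x ∈ E e, ρ z ≤ ρ x) ∧ x ∈ E e ∧ x ≠ z} ρ (Set.toFinite _)
      ⟨y, i, ⟨hi, hzi, hmin⟩, hy, hyz⟩
    obtain ⟨e, he, hxe, hxz⟩ := hx
    exact ⟨e, fun _ _ => ⟨he, fun j hj hzj hjm x' hx' hne =>
      ⟨x, hxe, hxz, hxmin x' ⟨j, ⟨hj, hzj, hjm⟩, hx', hne⟩⟩⟩⟩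
  choose g hg using hg
  have main : ∀ t ≤ ρ v, ∃ w ω, (∀ i ∉ S, ω i = ω₀ i) ∧ Invariant E S Z ρ g c t w ω := by
    intro t
    induction t with
    | zero =>
      refine fun _ => ⟨0, fun i => if i ∈ S then 3 else ω₀ i, fun i hi => if_neg hi, ?_, ?_, ?_, ?_⟩
      · simp
      · simp
      · exact fun i _ p hp => absurd hp.2.1 (by omega)
      · exact fun i hi _ => if_pos hi
    | succ t ih =>
      intro ht
      obtain ⟨w, ω, hω, hI⟩ := ih (by omega)
      by_cases h : ∃ z ∈ Z, ρ z = t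
      · obtain ⟨z, hz, hzt⟩ := h
        have hnv : ∀ q, ρ q ≤ t → q ≠ v := by
          rintro q hq rfl
          omega
        obtain ⟨w', ω', hω', hI'⟩ := hI.step hlin hSZ hinj hz hzt (hg z hz (hnv z hzt.le)).1
          fun p hp hpt => (hg p hp (hnv p hpt.le)).2
        exact ⟨w', ω', fun i hi => (hω' i hi).trans (hω i hi), hI'⟩
      · push Not at h
        exact ⟨w, ω, hω, hI.of_forall_ne hSZ h⟩
  obtain ⟨w, ω, hω, hI⟩ := main (ρ v) le_rfl
  obtain ⟨ω', hω', h⟩ := hI.finish hlin hSZ hS hinj hv hlast hne h₁ h₂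
  exact ⟨ω', fun i hi => (hω' i hi).trans (hω i hi), h⟩

end Greedy

section Induction

variable {E : ι → Finset V} {c : V → ℤ} {r k : ℕ}

/-- The inductive claim: some weighting makes every edge that has at least two vertices and meets
another edge non-monochromatic. Edges of size at most one are allowed. -/
def Solvable [Fintype ι] (c : V → ℤ) (k : ℕ) (E : ι → Finset V) : Prop :=
  ∃ ω : ι → ℤ, (∀ i, 1 ≤ ω i ∧ ω i ≤ k) ∧
    ∀ i, 2 ≤ (E i).card → (∃ j ≠ i, (E i ∩ E j).Nonempty) → Proper E c ω i

/-- The weighting `ω` separates two vertices of each edge having at least two vertices in `B`. -/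
def ProperOn [Fintype ι] (E : ι → Finset V) (c : V → ℤ) (ω : ι → ℤ) (B : Finset V) : Prop :=
  ∀ i, 2 ≤ (E i ∩ B).card → ∃ u ∈ E i, ∃ v ∈ E i, u ∈ B ∧ v ∈ B ∧ wt E c ω u ≠ wt E c ω v

lemma wt_inter [Fintype ι] {ω : ι → ℤ} {B : Finset V} {v : V} (hv : v ∈ B) :
    wt (fun i => E i ∩ B) c ω v = wt E c ω v := by
  simp [wt, hv]

/-- Case of a vertex in two edges of size two. -/
lemma solvable_of_two_pairs [Fintype V] [Fintype ι] [DecidableEq ι]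
    (hk : 5 ≤ k) (hlin : ∀ i j, i ≠ j → (E i ∩ E j).card ≤ 1)
    (hres : ∀ B : Finset V, (∃ v ∉ B, ∃ i, v ∈ E i) →
      ∃ ω : ι → ℤ, (∀ i, 1 ≤ ω i ∧ ω i ≤ k) ∧ ProperOn E c ω B)
    {v : V} {i₁ i₂ : ι} (hne : i₁ ≠ i₂) (h₁ : (E i₁).card = 2 ∧ v ∈ E i₁)
    (h₂ : (E i₂).card = 2 ∧ v ∈ E i₂) : Solvable c k E := by
  obtain ⟨Z, ρ, hv, hinj, hlast, hcl, hfwd⟩ := exists_peeling E v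
  obtain ⟨ω₁, hω₁, hB⟩ := hres Zᶜ ⟨v, by simpa using hv, i₁, h₁.2⟩
  have hS : ∀ i, (E i).card = 2 ∧ v ∈ E i →
      i ∈ Finset.univ.filter fun i => 2 ≤ (E i).card ∧ E i ⊆ Z := by
    rintro i ⟨h2, hvi⟩
    have hlt : (E i \ Z).card < (E i).card := Finset.card_lt_card
      (Finset.ssubset_iff_subset_ne.2 ⟨Finset.sdiff_subset, fun h => by
        rw [← h, Finset.mem_sdiff] at hvi
        exact hvi.2 hv⟩)
    have h0 : (E i \ Z).card = 0 := by
      have := hcl i h2.ge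
      omega
    simpa [h2] using Finset.sdiff_eq_empty_iff_subset.1 (Finset.card_eq_zero.1 h0)
  obtain ⟨ω, hω, hωS⟩ := exists_greedy hlin
    (S := Finset.univ.filter fun i => 2 ≤ (E i).card ∧ E i ⊆ Z) (Z := Z) (ρ := ρ)
    (fun i hi => (Finset.mem_filter.1 hi).2.2) (fun i hi => (Finset.mem_filter.1 hi).2.1)
    hinj hv hlast (fun z hz hzv => by
      obtain ⟨i, hzi, hiZ, hi2, hle⟩ := hfwd z hz hzv
      exact ⟨i, by simp [hi2, hiZ], hzi, hle⟩)
    hne ⟨hS i₁ h₁, h₁⟩ ⟨hS i₂ h₂, h₂⟩ c ω₁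
  refine ⟨ω, fun i => ?_, fun i hi2 _ => ?_⟩
  · by_cases hi : i ∈ Finset.univ.filter fun i => 2 ≤ (E i).card ∧ E i ⊆ Z
    · have := (hωS i hi).1
      have : (5 : ℤ) ≤ k := by exact_mod_cast hk
      omega
    · rw [hω i hi]
      exact hω₁ i
  · by_cases hi : i ∈ Finset.univ.filter fun i => 2 ≤ (E i).card ∧ E i ⊆ Z
    · exact (hωS i hi).2
    · have h0 : (E i \ Z).card ≠ 0 := fun h => hi (by
        simpa [hi2] using Finset.sdiff_eq_empty_iff_subset.1 (Finset.card_eq_zero.1 h))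
      have h1 := hcl i hi2
      have hw : ∀ u ∈ Zᶜ, wt E c ω u = wt E c ω₁ u := fun u hu => wt_congr fun j hj =>
        hω j fun hjS => (Finset.mem_compl.1 hu) ((Finset.mem_filter.1 hjS).2.2 hj)
      obtain ⟨a, ha, b, hb, haZ, hbZ, hab⟩ := hB i (by
        rw [← Finset.sdiff_eq_inter_compl]
        omega)
      exact ⟨a, ha, b, hb, by rwa [hw a haZ, hw b hbZ]⟩

/-- Case where the edges of size two form a perfect matching of the covered vertices. -/
lemma solvable_of_matching [Fintype V] [Fintype ι] [DecidableEq ι]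
    (hrk : r + 1 ≤ k) (hlin : ∀ i j, i ≠ j → (E i ∩ E j).card ≤ 1)
    (hcard : ∀ i, (E i).card ≤ r)
    (hres : ∀ B : Finset V, (∃ v ∉ B, ∃ i, v ∈ E i) →
      ∃ ω : ι → ℤ, (∀ i, 1 ≤ ω i ∧ ω i ≤ k) ∧ ProperOn E c ω B)
    (hex : ∀ v i, v ∈ E i → ∃ j, (E j).card = 2 ∧ v ∈ E j)
    (huniq : ∀ v i j, (E i).card = 2 → v ∈ E i → (E j).card = 2 → v ∈ E j → i = j) :
    Solvable c k E := by
  by_cases hg : ∃ g, (E g).Nonempty ∧ (E g).card ≠ 2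
  swap
  · push Not at hg
    refine ⟨fun _ => 1, fun i => ⟨le_rfl, by show (1 : ℤ) ≤ k; exact_mod_cast (by omega : 1 ≤ k)⟩, ?_⟩
    rintro i - ⟨j, hji, x, hx⟩
    rw [Finset.mem_inter] at hx
    exact absurd (huniq x j i (hg j ⟨x, hx.2⟩) hx.2 (hg i ⟨x, hx.1⟩) hx.1) hji
  obtain ⟨g, ⟨x₁, hx₁⟩, hg2⟩ := hg
  obtain ⟨f, hf2, hxf⟩ := hex x₁ g hx₁
  have hfg : f ≠ g := by
    rintro rfl
    exact hg2 hf2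
  obtain ⟨y, hyf, hyx⟩ := Finset.exists_mem_ne (by omega : 1 < (E f).card) x₁
  have hfeq : ∀ u ∈ E f, u = x₁ ∨ u = y := by
    have hEq : {x₁, y} = E f := Finset.eq_of_subset_of_card_le
      (by simp [Finset.insert_subset_iff, hxf, hyf]) (by rw [Finset.card_pair hyx.symm, hf2])
    intro u hu
    simpa [← hEq] using hu
  have hyg : y ∉ E g := fun h => hfg (eq_of_mem_of_mem hlin hyx hyf hxf h hx₁)
  set B : Finset V := (insert y (E g))ᶜ with hBdef
  have hmemB : ∀ u, u ∈ B ↔ u ≠ y ∧ u ∉ E g := by simp [hBdef]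
  obtain ⟨ω₁, hω₁, hB⟩ := hres B ⟨y, by simp [hmemB], f, hyf⟩
  have hfB : ∀ u ∈ B, u ∉ E f := fun u hu huf => by
    obtain rfl | rfl := hfeq u huf
    · exact ((hmemB _).1 hu).2 hx₁
    · exact ((hmemB _).1 hu).1 rfl
  let C : Finset ι := Finset.univ.filter fun i => 3 ≤ (E i).card ∧ (E i ∩ B).card ≤ 1
  have hC : ∀ i ∈ C, i ≠ g → y ∈ E i ∧ (∃ x ∈ E g, x ∈ E i ∧ x ≠ x₁) ∧ ∃ a ∈ E i, a ∈ B := by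
    intro i hi hig
    obtain ⟨h3, h1⟩ := (Finset.mem_filter.1 hi).2
    have hdec : (E i).card ≤ (E i ∩ B).card + (E i ∩ E g).card + (E i ∩ {y}).card := by
      refine (Finset.card_le_card (t := (E i ∩ B ∪ E i ∩ E g) ∪ E i ∩ {y}) fun u hu => ?_).trans
        ((Finset.card_union_le _ _).trans (Nat.add_le_add_right (Finset.card_union_le _ _) _))
      have := hmemB u
      simp only [Finset.mem_union, Finset.mem_inter, Finset.mem_singleton]
      tauto
    have h4 := hlin i g hig
    have h5 : (E i ∩ {y}).card ≤ 1 :=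
      (Finset.card_le_card Finset.inter_subset_right).trans (by simp)
    obtain ⟨u, hu⟩ := Finset.card_pos.1 (by omega : 0 < (E i ∩ {y}).card)
    obtain ⟨x, hx⟩ := Finset.card_pos.1 (by omega : 0 < (E i ∩ E g).card)
    obtain ⟨a, ha⟩ := Finset.card_pos.1 (by omega : 0 < (E i ∩ B).card)
    rw [Finset.mem_inter] at hu hx ha
    have hyi : y ∈ E i := Finset.mem_singleton.1 hu.2 ▸ hu.1
    refine ⟨hyi, ⟨x, hx.2, hx.1, ?_⟩, a, ha⟩
    rintro rfl
    have hif : i = f := eq_of_mem_of_mem hlin hyx hyi hx.1 hyf hxf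
    rw [hif] at h3
    omega
  have hCcard : C.card ≤ (E g).card := by
    have : ∀ i, ∃ x, i ∈ C → x ∈ E g ∧ (i ≠ g → x ∈ E i ∧ x ≠ x₁) ∧ (i = g → x = x₁) := by
      intro i
      by_cases hig : i = g
      · exact ⟨x₁, fun _ => ⟨hx₁, fun h => absurd hig h, fun _ => rfl⟩⟩
      by_cases hi : i ∈ C
      · obtain ⟨-, ⟨x, hxg, hxi, hx⟩, -⟩ := hC i hi hig
        exact ⟨x, fun _ => ⟨hxg, fun _ => ⟨hxi, hx⟩, fun h => absurd h hig⟩⟩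
      · exact ⟨x₁, fun h => absurd h hi⟩
    choose m hm using this
    refine Finset.card_le_card_of_injOn m (fun i hi => (hm i hi).1) fun i hi j hj hij => ?_
    have hi' := hm i hi
    have hj' := hm j hj
    by_cases hig : i = g
    · by_contra hne
      have hjg : j ≠ g := fun h => hne (hig.trans h.symm)
      exact (hj'.2.1 hjg).2 (hij ▸ hi'.2.2 hig)
    by_cases hjg : j = g
    · exact absurd (hij.trans (hj'.2.2 hjg)) (hi'.2.1 hig).2
    have hne : m i ≠ y := fun h => hyg (h ▸ hi'.1)
    exact eq_of_mem_of_mem hlin hne (hi'.2.1 hig).1 (hC i hi hig).1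
      (hij ▸ (hj'.2.1 hjg).1) (hC j hj hjg).1
  have hpq : ∀ i, ∃ p q, i ∈ C → (p ∈ E f ∧ q ∉ E f) ∧ p ∈ E i ∧ q ∈ E i ∧
      (p ∈ E g ↔ q ∈ E g) := by
    intro i
    by_cases hi : i ∈ C
    swap
    · exact ⟨y, y, fun h => absurd h hi⟩
    by_cases hig : i = g
    · subst hig
      have h3 := (Finset.mem_filter.1 hi).2.1
      obtain ⟨q, hq, hqx⟩ := Finset.exists_mem_ne (by omega : 1 < (E i).card) x₁
      refine ⟨x₁, q, fun _ => ⟨⟨hxf, fun h => ?_⟩, hx₁, hq, by simp [hx₁, hq]⟩⟩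
      obtain h | h := hfeq q h
      · exact hqx h
      · exact hyg (h ▸ hq)
    · obtain ⟨hyi, -, a, ha, haB⟩ := hC i hi hig
      exact ⟨y, a, fun _ => ⟨⟨hyf, hfB a haB⟩, hyi, ha, by simp [hyg, ((hmemB a).1 haB).2]⟩⟩
  choose p q hpq using hpq
  have hgr := hcard g
  obtain ⟨a, ha1, hak, ha⟩ := exists_update E c ω₁ f k C (by omega) p q fun i hi => (hpq i hi).1
  set ω₂ := Function.update ω₁ f a with hω₂
  let C' : Finset ι := Finset.univ.filter fun i => (E i).card = 2 ∧ (E i ∩ E g).Nonempty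
  have hpq' : ∀ i, ∃ p q, i ∈ C' → (p ∈ E g ∧ q ∉ E g) ∧ p ∈ E i ∧ q ∈ E i := by
    intro i
    by_cases hi : i ∈ C'
    swap
    · exact ⟨y, y, fun h => absurd h hi⟩
    obtain ⟨h2, x, hx⟩ := (Finset.mem_filter.1 hi).2
    rw [Finset.mem_inter] at hx
    obtain ⟨q, hq, hqx⟩ := Finset.exists_mem_ne (by omega : 1 < (E i).card) x
    refine ⟨x, q, fun _ => ⟨⟨hx.2, fun h => ?_⟩, hx.1, hq⟩⟩
    exact hg2 (eq_of_mem_of_mem hlin hqx hq hx.1 h hx.2 ▸ h2)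
  choose p' q' hpq' using hpq'
  have hC'card : C'.card ≤ (E g).card := by
    refine Finset.card_le_card_of_injOn p' (fun i hi => (hpq' i hi).1.1) fun i hi j hj hij => ?_
    exact huniq (p' i) i j (Finset.mem_filter.1 hi).2.1 (hpq' i hi).2.1
      (Finset.mem_filter.1 hj).2.1 (hij ▸ (hpq' j hj).2.1)
  obtain ⟨b, hb1, hbk, hb⟩ := exists_update E c ω₂ g k C' (by omega) p' q'
    fun i hi => (hpq' i hi).1
  have hwB : ∀ u ∈ B, wt E c (Function.update ω₂ g b) u = wt E c ω₁ u := fun u hu => by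
    rw [wt_update, if_neg ((hmemB u).1 hu).2, hω₂, wt_update, if_neg (hfB u hu), add_zero, add_zero]
  refine ⟨Function.update ω₂ g b, fun i => ?_, fun i hi2 _ => ?_⟩
  · rw [hω₂]
    simp only [Function.update_apply]
    split_ifs
    exacts [⟨hb1, hbk⟩, ⟨ha1, hak⟩, hω₁ i]
  · by_cases hi : i ∈ C'
    · exact ⟨p' i, (hpq' i hi).2.1, q' i, (hpq' i hi).2.2, hb i hi⟩
    by_cases hiC : i ∈ C
    · refine ⟨p i, (hpq i hiC).2.1, q i, (hpq i hiC).2.2.1, ?_⟩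
      have := ha i hiC
      rw [wt_update E c ω₂, wt_update E c ω₂]
      simp only [(hpq i hiC).2.2.2]
      intro h
      exact this (by linarith)
    · have hiB : 2 ≤ (E i ∩ B).card := by
        by_cases h2 : (E i).card = 2
        · have hig : ∀ u ∈ E i, u ∉ E g := fun u hu hug =>
            hi (Finset.mem_filter.2 ⟨Finset.mem_univ _, h2, u, Finset.mem_inter.2 ⟨hu, hug⟩⟩)
          have hiy : ∀ u ∈ E i, u ≠ y := by
            rintro u hu rfl
            exact hig x₁ (huniq u i f h2 hu hf2 hyf ▸ hxf) hx₁
          rw [Finset.inter_eq_left.2 fun u hu => (hmemB u).2 ⟨hiy u hu, hig u hu⟩]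
          exact hi2
        · by_contra h
          exact hiC (Finset.mem_filter.2 ⟨Finset.mem_univ _, by omega, by omega⟩)
      obtain ⟨u, hu, v, hv, huB, hvB, huv⟩ := hB i hiB
      exact ⟨u, hu, v, hv, by rwa [hwB u huB, hwB v hvB]⟩

theorem solvable [Fintype V] [Fintype ι] [DecidableEq ι]
    (hk : 5 ≤ k) (hrk : r + 1 ≤ k) (c : V → ℤ) (n : ℕ) (E : ι → Finset V)
    (hn : ∑ i, (E i).card = n) (hlin : ∀ i j, i ≠ j → (E i ∩ E j).card ≤ 1)
    (hcard : ∀ i, (E i).card ≤ r) : Solvable c k E := by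
  induction n using Nat.strong_induction_on generalizing E with
  | _ n ih =>
  have hrestrict : ∀ B : Finset V, (∃ v ∉ B, ∃ i, v ∈ E i) →
      ∃ ω : ι → ℤ, (∀ i, 1 ≤ ω i ∧ ω i ≤ k) ∧ ∀ i, 2 ≤ (E i ∩ B).card →
        (∃ j ≠ i, ∃ x ∈ B, x ∈ E i ∧ x ∈ E j) →
          ∃ u ∈ E i, ∃ v ∈ E i, u ∈ B ∧ v ∈ B ∧ wt E c ω u ≠ wt E c ω v := by
    rintro B ⟨v, hvB, i, hvi⟩
    have hlt : ∑ i, (E i ∩ B).card < n := by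
      rw [← hn]
      refine Finset.sum_lt_sum (fun j _ => Finset.card_le_card Finset.inter_subset_left)
        ⟨i, Finset.mem_univ _, Finset.card_lt_card (Finset.ssubset_iff_subset_ne.2
          ⟨Finset.inter_subset_left, fun h => hvB ?_⟩)⟩
      rw [← h] at hvi
      exact (Finset.mem_inter.1 hvi).2
    obtain ⟨ω, hω, h⟩ := ih _ hlt (fun i => E i ∩ B) rfl
      (fun i j hij => (Finset.card_le_card (Finset.inter_subset_inter Finset.inter_subset_left
        Finset.inter_subset_left)).trans (hlin i j hij))
      fun i => (Finset.card_le_card Finset.inter_subset_left).trans (hcard i)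
    refine ⟨ω, hω, fun i hi2 ⟨j, hji, x, hxB, hxi, hxj⟩ => ?_⟩
    obtain ⟨u, hu, v, hv, huv⟩ := h i hi2 ⟨j, hji, x, by simp [*]⟩
    rw [Finset.mem_inter] at hu hv
    rw [wt_inter hu.2, wt_inter hv.2] at huv
    exact ⟨u, hu.1, v, hv.1, hu.2, hv.2, huv⟩
  by_cases hdeg : ∃ i, ∃ u ∈ E i, ∃ w ∈ E i, u ≠ w ∧ ∀ j, j ≠ i → u ∉ E j ∧ w ∉ E j
  · obtain ⟨i, u, hu, w, hw, huw, hj⟩ := hdeg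
    by_cases hiso : ∃ j ≠ i, (E i ∩ E j).Nonempty
    · obtain ⟨j, hji, x, hx⟩ := hiso
      rw [Finset.mem_inter] at hx
      have hxu : x ≠ u := by
        rintro rfl
        exact (hj j hji).1 hx.2
      have hxw : x ≠ w := by
        rintro rfl
        exact (hj j hji).2 hx.2
      obtain ⟨ω, hω, h⟩ := hrestrict {w}ᶜ ⟨w, by simp, i, hw⟩
      refine ⟨ω, hω, fun l hl2 ⟨m, hml, y, hy⟩ => ?_⟩
      rw [Finset.mem_inter] at hy
      suffices 2 ≤ (E l ∩ {w}ᶜ).card ∧ ∃ j ≠ l, ∃ x ∈ ({w}ᶜ : Finset V), x ∈ E l ∧ x ∈ E j by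
        obtain ⟨a, ha, b, hb, -, -, hab⟩ := h l this.1 this.2
        exact ⟨a, ha, b, hb, hab⟩
      by_cases hli : l = i
      · subst hli
        exact ⟨Finset.one_lt_card.2 ⟨x, by simp [hx, hxw], u, by simp [hu, huw], hxu⟩,
          j, hji, x, by simp [hxw], hx⟩
      · have hwl := (hj l hli).2
        have hyw : y ≠ w := by
          rintro rfl
          exact hwl hy.1
        rw [Finset.inter_eq_left.2 fun z hz => by
          rw [Finset.mem_compl, Finset.mem_singleton]
          rintro rfl
          exact hwl hz]
        exact ⟨hl2, m, hml, y, by simp [hyw], hy⟩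
    · push Not at hiso
      have hdisj : ∀ l, l ≠ i → ∀ x ∈ E l, x ∉ E i := fun l hl x hxl hxi => by
        have := hiso l hl
        exact Finset.notMem_empty x (this ▸ Finset.mem_inter.2 ⟨hxi, hxl⟩)
      obtain ⟨ω, hω, h⟩ := hrestrict (E i)ᶜ ⟨u, by simp [hu], i, hu⟩
      refine ⟨ω, hω, fun l hl2 ⟨m, hml, y, hy⟩ => ?_⟩
      have hli : l ≠ i := by
        rintro rfl
        rw [hiso m hml] at hy
        exact Finset.notMem_empty y hy
      rw [Finset.mem_inter] at hy
      obtain ⟨a, ha, b, hb, -, -, hab⟩ := h l (by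
        rwa [Finset.inter_eq_left.2 fun z hz => Finset.mem_compl.2 (hdisj l hli z hz)])
        ⟨m, hml, y, Finset.mem_compl.2 (hdisj l hli y hy.1), hy⟩
      exact ⟨a, ha, b, hb, hab⟩
  have hres : ∀ B : Finset V, (∃ v ∉ B, ∃ i, v ∈ E i) →
      ∃ ω : ι → ℤ, (∀ i, 1 ≤ ω i ∧ ω i ≤ k) ∧ ProperOn E c ω B := by
    intro B hB
    obtain ⟨ω, hω, h⟩ := hrestrict B hB
    refine ⟨ω, hω, fun i hi => h i hi ?_⟩
    obtain ⟨u, hu, w, hw, huw⟩ := Finset.one_lt_card.1 hi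
    rw [Finset.mem_inter] at hu hw
    by_contra hno
    push Not at hno
    exact hdeg ⟨i, u, hu.1, w, hw.1, huw, fun j hj =>
      ⟨hno j hj u hu.2 hu.1, hno j hj w hw.2 hw.1⟩⟩
  by_cases hex : ∀ v i, v ∈ E i → ∃ j, (E j).card = 2 ∧ v ∈ E j
  · by_cases huniq : ∀ v i j, (E i).card = 2 → v ∈ E i → (E j).card = 2 → v ∈ E j → i = j
    · exact solvable_of_matching hrk hlin hcard hres hex huniq
    · push Not at huniq
      obtain ⟨v, i, j, hi, hvi, hj, hvj, hij⟩ := huniq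
      exact solvable_of_two_pairs hk hlin hres hij ⟨hi, hvi⟩ ⟨hj, hvj⟩
  · push Not at hex
    obtain ⟨v, i, hvi, hv⟩ := hex
    obtain ⟨ω, hω, h⟩ := hres {v}ᶜ ⟨v, by simp, i, hvi⟩
    refine ⟨ω, hω, fun l hl2 _ => ?_⟩
    obtain ⟨a, ha, b, hb, -, -, hab⟩ := h l (by
      rw [← Finset.sdiff_eq_inter_compl, Finset.sdiff_singleton_eq_erase]
      by_cases hvl : v ∈ E l
      · have : (E l).card ≠ 2 := fun h => hv l h hvl
        rw [Finset.card_erase_of_mem hvl]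
        omega
      · rwa [Finset.erase_eq_of_notMem hvl])
    exact ⟨a, ha, b, hb, hab⟩

end Induction

end LinearHypergraph

/-- For every linear hypergraph `H` in which every edge has size between
`2` and `r ≥ 2`, without isolated edges (every edge meets some other edge), and for every
vertex pre-weighting `ω' : V → ℕ`, there is an edge weighting
`ω : ι → {1, …, max 5 (r+1)}` such that the induced vertex weights
`ω(v) = ω'(v) + ∑_{e ∋ v} ω(e)` properly color `V`: every edge contains two vertices
with different induced weights. -/
theorem vertex_coloring_weighting_of_linear_preweighted {V ι : Type*} [Fintype V]
    [Fintype ι] [DecidableEq V] (r : ℕ) (hr : 2 ≤ r) (E : ι → Finset V)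
    (hsize : ∀ i, 2 ≤ (E i).card ∧ (E i).card ≤ r)
    (hlinear : ∀ i j, i ≠ j → (E i ∩ E j).card ≤ 1)
    (hiso : ∀ i, ∃ j, j ≠ i ∧ (E i ∩ E j).Nonempty)
    (ω' : V → ℕ) :
    ∃ ω : ι → ℕ, (∀ i, 1 ≤ ω i ∧ ω i ≤ max 5 (r + 1)) ∧
      ∀ i, ∃ u ∈ E i, ∃ v ∈ E i,
        (ω' u + ∑ j, if u ∈ E j then ω j else 0) ≠
          (ω' v + ∑ j, if v ∈ E j then ω j else 0) := by
  classical
  obtain ⟨ω, hω, h⟩ := LinearHypergraph.solvable (k := max 5 (r + 1)) (le_max_left _ _)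
    (le_max_right _ _) (fun v => (ω' v : ℤ)) _ E rfl hlinear fun i => (hsize i).2
  refine ⟨fun i => (ω i).toNat, fun i => ?_, fun i => ?_⟩
  · have h_low := (hω i).1
    exact ⟨(Int.le_toNat (by omega)).2 h_low, Int.toNat_le.2 (hω i).2⟩
  · obtain ⟨u, hu, v, hv, huv⟩ := h i (hsize i).1 (hiso i)
    have hcast : ∀ x, ((ω' x + ∑ j, if x ∈ E j then (ω j).toNat else 0 : ℕ) : ℤ) =
        LinearHypergraph.wt E (fun v => (ω' v : ℤ)) ω x := by
      intro x
      simp only [LinearHypergraph.wt, Nat.cast_add, Nat.cast_sum, Nat.cast_ite, Nat.cast_zero]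
      congr 1
      refine Finset.sum_congr rfl fun j _ => ?_
      rw [Int.toNat_of_nonneg (by have := hω j; omega)]
    refine ⟨u, hu, v, hv, fun heq => huv ?_⟩
    rw [← hcast, ← hcast]
    exact congrArg Nat.cast heq
end

section
/- For every hypergraph H in which every edge has size 2 or 3, and in which no edge consists of twins, there exists an edge weighting ω : E(H) → {1, 2, 3, 4, 5} such that the induced vertex weights properly color V(H), i.e., every edge of H contains at least two vertices with different induced weights. -/
/-- Two-element sets `{a, b}`, `{c, d}`, `{e, f}` of integers have pairwise disjoint translates by
elements of `{1, 2, 3, 4, 5}`. -/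
def DisjointTranslates (a b c d e f : ℤ) : Prop :=
  ∃ x y z : ℤ, (1 ≤ x ∧ x ≤ 5) ∧ (1 ≤ y ∧ y ≤ 5) ∧ (1 ≤ z ∧ z ≤ 5) ∧
    (a + x ≠ c + y ∧ a + x ≠ d + y ∧ b + x ≠ c + y ∧ b + x ≠ d + y) ∧
    (a + x ≠ e + z ∧ a + x ≠ f + z ∧ b + x ≠ e + z ∧ b + x ≠ f + z) ∧
    (c + y ≠ e + z ∧ c + y ≠ f + z ∧ d + y ≠ e + z ∧ d + y ≠ f + z)

theorem disjointTranslates_of_sorted (a b c d e f : ℤ) (hab : a < b) (hcd : c < d) (hef : e < f)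
    (hac : a ≤ c) (hce : c ≤ e) : DisjointTranslates a b c d e f := by
  by_contra H
  have K : ∀ x y z : ℤ, (0 ≤ x ∧ x ≤ 4) ∧ (0 ≤ y ∧ y ≤ 4) ∧ (0 ≤ z ∧ z ≤ 4) →
      a + x = c + y ∨ a + x = d + y ∨ b + x = c + y ∨ b + x = d + y ∨
      a + x = e + z ∨ a + x = f + z ∨ b + x = e + z ∨ b + x = f + z ∨
      c + y = e + z ∨ c + y = f + z ∨ d + y = e + z ∨ d + y = f + z := by
    intro x y z h
    by_contra! h'
    refine H ⟨x + 1, y + 1, z + 1, by omega, by omega, by omega, ?_, ?_, ?_⟩ <;>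
      refine ⟨?_, ?_, ?_, ?_⟩ <;> omega
  clear H
  obtain h | h | h | h | h | h : b = c + 2 ∨ b = d + 2 ∨ b = e + 4 ∨ b = f + 4 ∨ d + 2 = e + 4 ∨ d + 2 = f + 4 := by
      have := K 0 2 4 (by decide)
      omega
  · obtain h | h : d + 3 = e + 4 ∨ d + 3 = f + 4 := by
        have := K 0 3 4 (by decide)
        omega
    · have : b = d + 1 := by have := K 0 1 3 (by decide); omega
      have : a = c := by have := K 0 0 3 (by decide); omega
      have : b + 2 = f + 3 := by have := K 2 0 3 (by decide); omega
      have := K 4 0 2 (by decide)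
      omega
    · have : d + 1 = e + 4 := by have := K 0 1 4 (by decide); omega
      have := K 0 1 3 (by decide)
      omega
  · obtain h | h | h | h : b = e + 4 ∨ b = f + 4 ∨ d + 1 = e + 4 ∨ d + 1 = f + 4 := by
        have := K 0 1 4 (by decide)
        omega
    · obtain h | h : b = f + 2 ∨ d + 1 = f + 2 := by
          have := K 0 1 2 (by decide)
          omega
      · have : a + 1 = c := by have := K 1 0 4 (by decide); omega
        have := K 0 0 1 (by decide)
        omega
      · have : a + 1 = c := by have := K 1 0 3 (by decide); omega
        have := K 2 0 3 (by decide)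
        omega
    · have := K 0 1 2 (by decide)
      omega
    · obtain h | h : b = f + 2 ∨ d + 1 = f + 2 := by
          have := K 0 1 2 (by decide)
          omega
      · have := K 0 1 3 (by decide)
        omega
      · have : a + 2 = c := by have := K 2 0 4 (by decide); omega
        have := K 0 0 2 (by decide)
        omega
    · have := K 0 1 2 (by decide)
      omega
  · obtain h | h | h | h : b = d + 1 ∨ b = f + 3 ∨ d + 1 = e + 3 ∨ d + 1 = f + 3 := by
        have := K 0 1 3 (by decide)
        omega
    · obtain h | h : b = f + 3 ∨ d + 2 = f + 3 := by
          have := K 0 2 3 (by decide)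
          omega
      · have : a + 2 = c := by have := K 2 0 4 (by decide); omega
        have := K 0 0 1 (by decide)
        omega
      · obtain h | h : a + 3 = c ∨ a + 3 = d := by
            have := K 3 0 4 (by decide)
            omega
        · have := K 1 0 2 (by decide)
          omega
        · have := K 0 2 1 (by decide)
          omega
    · obtain h | h | h : b = d + 1 ∨ d + 1 = e + 2 ∨ d + 1 = f + 2 := by
          have := K 0 1 2 (by decide)
          omega
      · have : a + 2 = c := by have := K 2 0 4 (by decide); omega
        have := K 0 0 1 (by decide)
        omega
      · have : a = c := by have := K 0 0 2 (by decide); omega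
        have : a + 1 = d := by have := K 1 0 2 (by decide); omega
        have := K 2 0 3 (by decide)
        omega
      · have : a + 1 = c := by have := K 1 0 3 (by decide); omega
        have := K 2 0 3 (by decide)
        omega
    · obtain h | h : b = f + 2 ∨ d + 1 = f + 2 := by
          have := K 0 1 2 (by decide)
          omega
      · have : a + 1 = c := by have := K 1 0 4 (by decide); omega
        have := K 0 0 1 (by decide)
        omega
      · have : a + 1 = c := by have := K 1 0 3 (by decide); omega
        have := K 2 0 3 (by decide)
        omega
    · have : b = f + 3 := by have := K 0 2 3 (by decide); omega
      have : a + 2 = c := by have := K 2 0 4 (by decide); omega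
      have := K 0 0 1 (by decide)
      omega
  · obtain h | h | h : b = d + 1 ∨ d + 1 = e + 2 ∨ d + 1 = f + 2 := by
        have := K 0 1 2 (by decide)
        omega
    · have := K 0 2 3 (by decide)
      omega
    · have := K 0 1 3 (by decide)
      omega
    · obtain h | h : c + 4 = e + 1 ∨ c + 4 = f + 1 := by
          have := K 0 4 1 (by decide)
          omega
      · have := K 0 1 0 (by decide)
        omega
      · have : a = e := by have := K 0 4 0 (by decide); omega
        have := K 0 1 3 (by decide)
        omega
  · obtain h | h | h | h : b = c + 1 ∨ b = d + 1 ∨ b = e + 4 ∨ b = f + 4 := by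
        have := K 0 1 4 (by decide)
        omega
    · have : a = c := by have := K 0 0 3 (by decide); omega
      have : d + 2 = f + 3 := by have := K 0 2 3 (by decide); omega
      have : c + 2 = e + 2 := by have := K 0 2 2 (by decide); omega
      have := K 0 4 2 (by decide)
      omega
    · have : a = c := by have := K 0 0 4 (by decide); omega
      have : b + 1 = f + 3 := by have := K 1 0 3 (by decide); omega
      have : a + 2 = d := by have := K 2 0 3 (by decide); omega
      have := K 0 4 1 (by decide)
      omega
    · obtain h | h : b = f + 2 ∨ d + 1 = f + 2 := by
          have := K 0 1 2 (by decide)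
          omega
      · have : a + 1 = c := by have := K 1 0 4 (by decide); omega
        have := K 0 0 1 (by decide)
        omega
      · have : a + 1 = c := by have := K 1 0 3 (by decide); omega
        have := K 2 0 3 (by decide)
        omega
    · have : a + 1 = c := by have := K 1 0 3 (by decide); omega
      have := K 0 0 3 (by decide)
      omega
  · obtain h | h | h | h : b = c + 3 ∨ b = d + 3 ∨ b = e + 4 ∨ b = f + 4 := by
        have := K 0 3 4 (by decide)
        omega
    · obtain h | h : b = e + 2 ∨ b = f + 2 := by
          have := K 0 1 2 (by decide)
          omega
      · have := K 0 2 3 (by decide)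
        omega
      · have := K 0 4 1 (by decide)
        omega
    · have := K 0 1 2 (by decide)
      omega
    · have : b = f + 3 := by have := K 0 2 3 (by decide); omega
      have : a + 2 = c := by have := K 2 0 4 (by decide); omega
      have := K 0 0 1 (by decide)
      omega
    · have := K 0 1 2 (by decide)
      omega

theorem disjointTranslates (a b c d e f : ℤ) (hab : a ≠ b) (hcd : c ≠ d) (hef : e ≠ f) :
    DisjointTranslates a b c d e f := by
  wlog h₁ : a < b generalizing a b
  · obtain ⟨x, y, z, h⟩ := this b a hab.symm (by omega)
    exact ⟨x, y, z, by tauto⟩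
  wlog h₂ : c < d generalizing c d
  · obtain ⟨x, y, z, h⟩ := this d c hcd.symm (by omega)
    exact ⟨x, y, z, by tauto⟩
  wlog h₃ : e < f generalizing e f
  · obtain ⟨x, y, z, h⟩ := this f e hef.symm (by omega)
    exact ⟨x, y, z, by tauto⟩
  clear hab hcd hef
  wlog h₄ : a ≤ c generalizing a b c d
  · obtain ⟨x, y, z, h⟩ := this c d h₂ a b h₁ (by omega)
    exact ⟨y, x, z, by omega⟩
  rcases le_total c e with h₅ | h₅
  · exact disjointTranslates_of_sorted a b c d e f h₁ h₂ h₃ h₄ h₅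
  rcases le_total a e with h₆ | h₆
  · obtain ⟨x, y, z, h⟩ := disjointTranslates_of_sorted a b e f c d h₁ h₃ h₂ h₆ h₅
    exact ⟨x, z, y, by omega⟩
  · obtain ⟨x, y, z, h⟩ := disjointTranslates_of_sorted e f a b c d h₃ h₁ h₂ h₆ h₄
    exact ⟨y, z, x, by omega⟩


theorem exists_mem_Icc_forall_ne {V : Type*} (b : ℤ) (Y : Finset V) (low : V → ℤ) :
    ∃ m, b ≤ m ∧ m ≤ b + 2 * Y.card ∧ ∀ y ∈ Y, m ≠ low y ∧ m ≠ low y + 2 := by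
  classical
  have hcard : (Y.image low ∪ Y.image fun y => low y + 2).card <
      (Finset.Icc b (b + 2 * Y.card)).card := by
    have h1 := Finset.card_union_le (Y.image low) (Y.image fun y => low y + 2)
    have h2 := Finset.card_image_le (s := Y) (f := low)
    have h3 := Finset.card_image_le (s := Y) (f := fun y => low y + 2)
    rw [Int.card_Icc]
    omega
  obtain ⟨m, hm, hm'⟩ := Finset.exists_mem_notMem_of_card_lt_card hcard
  simp only [Finset.mem_Icc, Finset.mem_union, Finset.mem_image, not_or, not_exists, not_and]
    at hm hm'
  exact ⟨m, hm.1, hm.2, fun y hy => ⟨fun h => hm'.1 y hy h.symm, fun h => hm'.2 y hy h.symm⟩⟩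

theorem exists_low_up_tweak (b m : ℤ) (d : ℕ) (h₁ : b ≤ m) (h₂ : m ≤ b + 2 * d) :
    ∃ (j : ℕ) (x l u : ℤ), j ≤ d ∧ b + 2 * j + x = m ∧ m = l + 2 * u ∧ (l % 4 = 0 ∨ l % 4 = 1) ∧
      (u = 0 ∨ u = 1) ∧ -1 ≤ x ∧ x ≤ 1 ∧ (u = 0 → x ≤ 0) ∧ (u = 1 → 0 ≤ x) := by
  obtain ⟨l, u, h3, h4, h5⟩ : ∃ l u : ℤ, m = l + 2 * u ∧ (l % 4 = 0 ∨ l % 4 = 1) ∧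
      (u = 0 ∨ u = 1) := by
    by_cases h : m % 4 = 0 ∨ m % 4 = 1
    · exact ⟨m, 0, by omega, h, by omega⟩
    · exact ⟨m - 2, 1, by omega, by omega, by omega⟩
  rcases Int.emod_two_eq_zero_or_one (m - b) with h | h
  · exact ⟨((m - b) / 2).toNat, 0, l, u, by omega⟩
  · rcases h5 with h5 | h5
    · exact ⟨((m - b + 1) / 2).toNat, -1, l, u, by omega⟩
    · exact ⟨((m - b - 1) / 2).toNat, 1, l, u, by omega⟩

section Weights

variable {V ι : Type*} [Fintype ι] [DecidableEq V]

/-- The vertex weight induced by an edge weighting. -/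
def vertexWeight (E : ι → Finset V) (ω : ι → ℤ) (v : V) : ℤ :=
  ∑ i, if v ∈ E i then ω i else 0

theorem vertexWeight_add (E : ι → Finset V) (ω δ : ι → ℤ) (v : V) :
    vertexWeight E (fun i => ω i + δ i) v = vertexWeight E ω v + vertexWeight E δ v := by
  simp only [vertexWeight, ← Finset.sum_add_distrib]
  exact Finset.sum_congr rfl fun i _ => by split_ifs <;> simp

theorem vertexWeight_single [DecidableEq ι] (E : ι → Finset V) (j : ι) (c : ℤ) (v : V) :
    vertexWeight E (fun i => if i = j then c else 0) v = if v ∈ E j then c else 0 := by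
  unfold vertexWeight
  rw [Finset.sum_eq_single j]
  · simp
  · intro i _ hi
    simp [hi]
  · simp

theorem vertexWeight_congr {E : ι → Finset V} {ω ω' : ι → ℤ} {v : V}
    (h : ∀ i, v ∈ E i → ω i = ω' i) : vertexWeight E ω v = vertexWeight E ω' v :=
  Finset.sum_congr rfl fun i _ => by
    split_ifs with hv
    · exact h i hv
    · rfl

theorem vertexWeight_sum_single [DecidableEq ι] (E : ι → Finset V) (Y : Finset V) (rep : V → ι)
    (δ : V → ℤ) (v : V) :
    vertexWeight E (fun i => ∑ y ∈ Y, if i = rep y then δ y else 0) v =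
      ∑ y ∈ Y, if v ∈ E (rep y) then δ y else 0 := by
  simp only [← vertexWeight_single E]
  unfold vertexWeight
  rw [Finset.sum_comm]
  refine Finset.sum_congr rfl fun i _ => ?_
  split_ifs <;> simp

/-- The edges in `J` are oriented along the rank function `ρ`: each has a vertex `p i` of smallest
rank, followed by `s i`, and the vertices of rank below `K` are exactly those of the form `p i`. -/
structure OrientedBy (E : ι → Finset V) (J : Set ι) (p s : ι → V) (ρ : V → ℕ) (K : ℕ) : Prop where
  p_mem : ∀ i ∈ J, p i ∈ E i
  s_mem : ∀ i ∈ J, s i ∈ E i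
  lt : ∀ i ∈ J, ρ (p i) < ρ (s i)
  le : ∀ i ∈ J, ∀ z ∈ E i, z ≠ p i → ρ (s i) ≤ ρ z
  p_lt : ∀ i ∈ J, ρ (p i) < K
  exists_edge : ∀ v, ρ v < K → ∃ i ∈ J, p i = v
  inj : ∀ u v, ρ u < K → ρ u = ρ v → u = v

/-- All vertices of rank below `k` have been processed: such a vertex `v` has weight `low v` or
`low v + 2`, according to whether `up v` is `0` or `1`. -/
structure Processed (E : ι → Finset V) (J : Set ι) (p s : ι → V) (ρ : V → ℕ) (ω₀ : ι → ℤ) (k : ℕ)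
    (ω : ι → ℤ) (low up : V → ℤ) : Prop where
  off : ∀ i ∉ J, ω i = ω₀ i
  range : ∀ i ∈ J, 1 ≤ ω i ∧ ω i ≤ 5
  low_mod : ∀ v, ρ v < k → low v % 4 = 0 ∨ low v % 4 = 1
  up_eq : ∀ v, ρ v < k → up v = 0 ∨ up v = 1
  weight : ∀ v, ρ v < k → vertexWeight E ω v = low v + 2 * up v
  low_ne : ∀ i ∈ J, ρ (s i) < k → low (p i) ≠ low (s i)
  slack : ∀ i ∈ J, ρ (p i) < k → k ≤ ρ (s i) →
    (up (p i) = 0 → ω i ≤ 3) ∧ (up (p i) = 1 → 3 ≤ ω i)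
  tweaked : ∀ i ∈ J, ρ (p i) < k → k ≤ ρ (s i) → ω i ≠ 3 →
    ∀ j ∈ J, p j = p i → ρ (s i) ≤ ρ (s j)
  untouched : ∀ i ∈ J, k ≤ ρ (p i) → ω i = 3

variable {E : ι → Finset V} {J : Set ι} {p s : ι → V} {ρ : V → ℕ} {K k : ℕ} {ω₀ ω : ι → ℤ}
  {low up : V → ℤ}

open Classical in
/-- The vertices preceding `v` on some edge whose second vertex is `v`. -/
noncomputable def backNeighbors (J : Set ι) (p s : ι → V) (v : V) : Finset V :=
  (Finset.univ.filter fun i => i ∈ J ∧ s i = v).image p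

theorem mem_backNeighbors {v y : V} :
    y ∈ backNeighbors J p s v ↔ ∃ i ∈ J, s i = v ∧ p i = y := by
  simp [backNeighbors, and_assoc]

/-- The edges towards `v` can be used to set the states of its back neighbors at will. -/
theorem Processed.exists_flip (hO : OrientedBy E J p s ρ K)
    (hP : Processed E J p s ρ ω₀ k ω low up) {v : V} (hk : k ≤ ρ v)
    (hY : ∀ y ∈ backNeighbors J p s v, ρ y < k) (G : Finset V) (hG : G ⊆ backNeighbors J p s v) :
    ∃ ω' : ι → ℤ, (∀ i ∉ J, ω' i = ω i) ∧ (∀ i, s i ≠ v → ω' i = ω i) ∧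
      (∀ i ∈ J, 1 ≤ ω' i ∧ ω' i ≤ 5) ∧
      (∀ z, ρ z < k → vertexWeight E ω' z = vertexWeight E ω z +
        if z ∈ backNeighbors J p s v then 2 * ((if z ∈ G then 1 else 0) - up z) else 0) ∧
      vertexWeight E ω' v =
        vertexWeight E ω v + 2 * G.card - 2 * ∑ y ∈ backNeighbors J p s v, up y := by
  classical
  set Y := backNeighbors J p s v with hYdef
  rcases isEmpty_or_nonempty ι with hι | hι
  · have hY0 : Y = ∅ := by
      ext y
      simp [hYdef, mem_backNeighbors]
    have hG0 : G = ∅ := by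
      rw [hY0] at hG
      exact Finset.subset_empty.1 hG
    refine ⟨ω, ?_⟩
    simp [hY0, hG0]
  have hrep : ∀ y, ∃ i, y ∈ Y → i ∈ J ∧ s i = v ∧ p i = y := by
    intro y
    by_cases hy : y ∈ Y
    · obtain ⟨i, hi⟩ := mem_backNeighbors.1 hy
      exact ⟨i, fun _ => hi⟩
    · exact ⟨Classical.arbitrary ι, fun h => absurd h hy⟩
  choose rep hrep using hrep
  set δ : V → ℤ := fun z => 2 * ((if z ∈ G then 1 else 0) - up z) with hδ
  have hval : ∀ i, (∑ y ∈ Y, if i = rep y then δ y else 0) = 0 ∨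
      (i ∈ J ∧ s i = v ∧ p i ∈ Y ∧ (∑ y ∈ Y, if i = rep y then δ y else 0) = δ (p i)) := by
    intro i
    by_cases h : ∃ y ∈ Y, i = rep y
    · obtain ⟨y, hy, rfl⟩ := h
      obtain ⟨h1, h2, h3⟩ := hrep y hy
      refine Or.inr ⟨h1, h2, by rwa [h3], ?_⟩
      rw [Finset.sum_eq_single y, if_pos rfl, h3]
      · intro y' hy' hne
        rw [if_neg]
        intro h
        apply hne
        rw [← (hrep y' hy').2.2, ← h, h3]
      · exact fun h => absurd hy h
    · left
      refine Finset.sum_eq_zero fun y hy => if_neg fun h' => h ⟨y, hy, h'⟩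
  refine ⟨fun i => ω i + ∑ y ∈ Y, if i = rep y then δ y else 0, ?_, ?_, ?_, ?_, ?_⟩
  · intro i hi
    rcases hval i with h | h
    · simp only [h, add_zero]
    · exact absurd h.1 hi
  · intro i hi
    rcases hval i with h | h
    · simp only [h, add_zero]
    · exact absurd h.2.1 hi
  · intro i hi
    have hr := hP.range i hi
    rcases hval i with h | ⟨-, h2, h3, h4⟩
    · simp only [h]
      omega
    · beta_reduce
      rw [h4]
      simp only [hδ]
      have h5 := hP.slack i hi (hY _ h3) (by rw [h2]; exact hk)
      rcases hP.up_eq _ (hY _ h3) with h6 | h6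
      · have := h5.1 h6
        split_ifs <;> omega
      · have := h5.2 h6
        split_ifs <;> omega
  · intro z hz
    rw [vertexWeight_add, vertexWeight_sum_single]
    congr 1
    have hmem : ∀ y ∈ Y, (z ∈ E (rep y) ↔ z = y) := by
      intro y hy
      obtain ⟨h1, h2, h3⟩ := hrep y hy
      constructor
      · intro h
        by_contra hne
        have := hO.le _ h1 z h (by rwa [h3])
        rw [h2] at this
        omega
      · rintro rfl
        have := hO.p_mem _ h1
        rwa [h3] at this
    rw [Finset.sum_congr rfl fun y hy => if_congr (hmem y hy) rfl rfl]
    exact Finset.sum_ite_eq Y z δ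
  · rw [vertexWeight_add, vertexWeight_sum_single]
    have hmem : ∀ y ∈ Y, v ∈ E (rep y) := by
      intro y hy
      obtain ⟨h1, h2, h3⟩ := hrep y hy
      have := hO.s_mem _ h1
      rwa [h2] at this
    rw [Finset.sum_congr rfl fun y hy => if_pos (hmem y hy), ← Finset.mul_sum,
      Finset.sum_sub_distrib, Finset.sum_boole, Finset.filter_mem_eq_inter,
      Finset.inter_eq_right.2 hG]
    ring

theorem Processed.exists_succ (hO : OrientedBy E J p s ρ K)
    (hP : Processed E J p s ρ ω₀ k ω low up) (hk : k < K) :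
    ∃ ω' low' up', Processed E J p s ρ ω₀ (k + 1) ω' low' up' := by
  classical
  by_cases hv : ∃ v, ρ v = k
  swap
  · have hv' : ∀ v, ρ v ≠ k := fun v h => hv ⟨v, h⟩
    have hlt : ∀ v, ρ v < k + 1 ↔ ρ v < k := fun v => by have := hv' v; omega
    have hle : ∀ v, k + 1 ≤ ρ v ↔ k ≤ ρ v := fun v => by have := hv' v; omega
    obtain ⟨h1, h2, h3, h4, h5, h6, h7, h8, h9⟩ := hP
    exact ⟨ω, low, up, by constructor <;> simpa only [hlt, hle]⟩
  obtain ⟨v, hv⟩ := hv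
  set Y := backNeighbors J p s v with hYdef
  have hY : ∀ y ∈ Y, ρ y < k := by
    intro y hy
    obtain ⟨i, hi, h1, h2⟩ := mem_backNeighbors.1 hy
    have := hO.lt i hi
    rw [h1, h2] at this
    omega
  obtain ⟨τ, hτ, hτmin⟩ : ∃ τ, (τ ∈ J ∧ p τ = v) ∧ ∀ j ∈ J, p j = v → ρ (s τ) ≤ ρ (s j) := by
    obtain ⟨i, hi, hpi⟩ := hO.exists_edge v (by omega)
    obtain ⟨τ, h1, h2⟩ := Finset.exists_min_image
      (Finset.univ.filter fun i => i ∈ J ∧ p i = v) (fun i => ρ (s i)) ⟨i, by simp [hi, hpi]⟩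
    refine ⟨τ, by simpa using h1, fun j hj hpj => h2 j (by simp [hj, hpj])⟩
  obtain ⟨hτJ, hpτ⟩ := hτ
  have hsτ : k < ρ (s τ) := by
    have := hO.lt τ hτJ
    rw [hpτ] at this
    omega
  set b := vertexWeight E ω v - 2 * ∑ y ∈ Y, up y with hb
  obtain ⟨m, hm1, hm2, hm3⟩ := exists_mem_Icc_forall_ne b Y low
  obtain ⟨j, x, l, u, hj, hjm, hml, hl, hu, hx1, hx2, hux0, hux1⟩ :=
    exists_low_up_tweak b m Y.card hm1 hm2
  obtain ⟨G, hG, hGcard⟩ := Finset.exists_subset_card_eq hj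
  obtain ⟨ω₁, hoff, hsame, hrange, hw, hwv⟩ := hP.exists_flip hO hv.ge hY G hG
  have hτω : ω₁ τ = 3 := by
    rw [hsame τ fun h => by rw [h] at hsτ; omega]
    exact hP.untouched τ hτJ (by rw [hpτ]; omega)
  set ω₂ : ι → ℤ := fun i => ω₁ i + if i = τ then x else 0 with hω₂
  have hne : ∀ z, ρ z < k → z ≠ v := by
    rintro z hz rfl
    omega
  have hω₂same : ∀ i, s i ≠ v → p i ≠ v → ω₂ i = ω i := by
    intro i hs hp
    have : i ≠ τ := by
      rintro rfl
      exact hp hpτ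
    simp only [hω₂, if_neg this, add_zero]
    exact hsame i hs
  have hW₂ : ∀ z, ρ z < k → vertexWeight E ω₂ z = vertexWeight E ω₁ z := by
    intro z hz
    rw [hω₂, vertexWeight_add, vertexWeight_single, if_neg, add_zero]
    intro h
    have := hO.le τ hτJ z h (by rw [hpτ]; exact hne z hz)
    omega
  have hW₂v : vertexWeight E ω₂ v = m := by
    rw [hω₂, vertexWeight_add, vertexWeight_single, if_pos (hpτ ▸ hO.p_mem τ hτJ), hwv, hGcard,
      ← hYdef]
    omega
  have hcases : ∀ z, ρ z < k + 1 → z = v ∨ (z ≠ v ∧ ρ z < k) := by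
    intro z hz
    by_cases h : z = v
    · exact Or.inl h
    · refine Or.inr ⟨h, ?_⟩
      have : ρ z ≠ ρ v := fun h' => h (hO.inj z v (by omega) h')
      omega
  refine ⟨ω₂, Function.update low v l,
    Function.update (fun z => if z ∈ Y then (if z ∈ G then 1 else 0) else up z) v u,
    ?_, ?_, ?_, ?_, ?_, ?_, ?_, ?_, ?_⟩
  · intro i hi
    have : i ≠ τ := by
      rintro rfl
      exact hi hτJ
    simp only [hω₂, if_neg this, add_zero]
    rw [hoff i hi, hP.off i hi]
  · intro i hi
    simp only [hω₂]
    split_ifs with h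
    · rw [h, hτω]
      omega
    · rw [add_zero]
      exact hrange i hi
  · intro z hz
    rcases hcases z hz with rfl | ⟨h, h'⟩
    · simpa using hl
    · simpa [h] using hP.low_mod z h'
  · intro z hz
    rcases hcases z hz with rfl | ⟨h, h'⟩
    · simpa using hu
    · have := hP.up_eq z h'
      simp only [Function.update_of_ne h]
      split_ifs <;> simp [this]
  · intro z hz
    rcases hcases z hz with rfl | ⟨h, h'⟩
    · simp only [Function.update_self]
      rw [hW₂v, hml]
    · simp only [Function.update_of_ne h]
      rw [hW₂ z h', hw z h', hP.weight z h']
      split_ifs <;> ring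
  · intro i hi hsi
    rcases hcases _ hsi with h | ⟨h, h'⟩
    · have hy : p i ∈ Y := mem_backNeighbors.2 ⟨i, hi, h, rfl⟩
      have h2 := hm3 _ hy
      rw [h, Function.update_self, Function.update_of_ne (hne _ (hY _ hy))]
      omega
    · have h2 := hO.lt i hi
      rw [Function.update_of_ne h, Function.update_of_ne (hne _ (by omega))]
      exact hP.low_ne i hi h'
  · intro i hi hpi hsi
    have hsv : s i ≠ v := by
      rintro rfl
      omega
    rcases hcases _ hpi with h | ⟨h, h'⟩
    · simp only [h, Function.update_self, hω₂]
      rw [hsame i hsv, hP.untouched i hi (by rw [h, hv])]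
      split_ifs
      · exact ⟨fun h => by have := hux0 h; omega, fun h => by have := hux1 h; omega⟩
      · simp
    · simp only [Function.update_of_ne h]
      rw [hω₂same i hsv h]
      split_ifs with hy hg
      all_goals try
        obtain ⟨i', hi', h1, h2⟩ := mem_backNeighbors.1 hy
        have : ω i = 3 := by
          by_contra h3
          have := hP.tweaked i hi h' (by omega) h3 i' hi' h2
          rw [h1] at this
          omega
        simp [this]
      exact hP.slack i hi h' (by omega)
  · intro i hi hpi hsi hω j' hj' hpj
    have hsv : s i ≠ v := by
      rintro rfl
      omega
    rcases hcases _ hpi with h | ⟨h, h'⟩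
    · have : i = τ := by
        by_contra hiτ
        apply hω
        simp only [hω₂, if_neg hiτ, add_zero]
        rw [hsame i hsv, hP.untouched i hi (by rw [h, hv])]
      subst this
      exact hτmin j' hj' (hpj.trans h)
    · rw [hω₂same i hsv h] at hω
      exact hP.tweaked i hi h' (by omega) hω j' hj' hpj
  · intro i hi hpi
    have h1 : s i ≠ v := by
      intro h
      have := hO.lt i hi
      rw [h] at this
      omega
    have h2 : p i ≠ v := by
      intro h
      rw [h] at hpi
      omega
    rw [hω₂same i h1 h2]
    exact hP.untouched i hi (by omega)

theorem OrientedBy.exists_processed (hO : OrientedBy E J p s ρ K) (ω₀ : ι → ℤ) :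
    ∃ ω low up, Processed E J p s ρ ω₀ K ω low up := by
  classical
  have key : ∀ k ≤ K, ∃ ω low up, Processed E J p s ρ ω₀ k ω low up := by
    intro k
    induction k with
    | zero =>
      intro _
      refine ⟨fun i => if i ∈ J then 3 else ω₀ i, 0, 0, ?_⟩
      constructor
      all_goals try (intros; omega)
      · intro i hi
        simp [hi]
      · intro i hi
        simp [hi]
      · intro i hi
        simp [hi]
    | succ k ih =>
      intro hk
      obtain ⟨ω, low, up, h⟩ := ih (by omega)
      exact h.exists_succ hO hk
  exact key K le_rfl

theorem Processed.vertexWeight_ne (hO : OrientedBy E J p s ρ K)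
    (hP : Processed E J p s ρ ω₀ k ω low up) {i : ι} (hi : i ∈ J) (hs : ρ (s i) < k) {g h : ℤ}
    (hg : g = 0 ∨ g = 1) (hh : h = 0 ∨ h = 1) :
    low (p i) + 2 * g ≠ low (s i) + 2 * h := by
  have h1 := hO.lt i hi
  have h2 := hP.low_mod _ hs
  have h3 := hP.low_mod (p i) (by omega)
  have h4 := hP.low_ne i hi hs
  omega

end Weights

/-- Every set `Q` of vertices extends to a set `S` that no edge leaves by exactly one vertex and
whose edges not contained in `Q` can be oriented. -/
theorem exists_closed_orientedBy {V ι : Type*} [Fintype V] [DecidableEq V] (E : ι → Finset V)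
    (hE : ∀ i, (E i).card ≠ 1)
    (Q : Finset V) (hQ : Q.Nonempty) :
    ∃ S, Q ⊆ S ∧ (∀ i, (E i \ S).card ≠ 1) ∧ ∃ (p s : ι → V) (ρ : V → ℕ) (K : ℕ),
      (∀ v, ρ v < K ↔ v ∈ S \ Q) ∧ OrientedBy E {i | E i ⊆ S ∧ ¬ E i ⊆ Q} p s ρ K := by
  classical
  let Good : Finset V → Prop := fun S => Q ⊆ S ∧ ∃ (ρ : V → ℕ) (K : ℕ),
    (∀ v, ρ v < K ↔ v ∈ S \ Q) ∧ (∀ u v, ρ u < K → ρ u = ρ v → u = v) ∧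
      ∀ v, ρ v < K → ∃ i, v ∈ E i ∧ E i ⊆ S ∧ ∀ z ∈ E i, z ≠ v → ρ v < ρ z
  have hgood : Good Q := ⟨subset_rfl, 0, 0, by simp, by simp, by simp⟩
  obtain ⟨S, hS, hmax⟩ := Finset.exists_max_image (Finset.univ.filter Good) Finset.card
    ⟨Q, by simpa using hgood⟩
  replace hS : Good S := by simpa using hS
  replace hmax : ∀ T, Good T → T.card ≤ S.card := by simpa using hmax
  obtain ⟨hQS, ρ, K, hρ, hinj, hedge⟩ := hS
  refine ⟨S, hQS, ?_, ?_⟩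
  · intro i hi
    obtain ⟨x, hx⟩ := Finset.card_eq_one.1 hi
    have hxi : x ∈ E i \ S := by simp [hx]
    rw [Finset.mem_sdiff] at hxi
    have hsub : E i ⊆ insert x S := by
      intro z hz
      by_cases hzS : z ∈ S
      · simp [hzS]
      · have : z ∈ E i \ S := by simp [hz, hzS]
        rw [hx, Finset.mem_singleton] at this
        simp [this]
    have hbig : Good (insert x S) := by
      refine ⟨hQS.trans (Finset.subset_insert _ _), fun v => if v = x then 0 else ρ v + 1, K + 1,
        ?_, ?_, ?_⟩
      · intro v
        have hv := hρ v
        simp only [Finset.mem_sdiff, Finset.mem_insert] at hv ⊢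
        by_cases h : v = x
        · subst h
          simpa using fun h' => hxi.2 (hQS h')
        · simp [h, hv]
      · intro u v hu huv
        by_cases h : u = x <;> by_cases h' : v = x <;> simp [h, h'] at hu huv ⊢
        exact hinj u v hu huv
      · intro v hv
        by_cases h : v = x
        · subst h
          exact ⟨i, hxi.1, hsub, fun z _ hz => by simp [hz]⟩
        · simp only [h, if_false, add_lt_add_iff_right] at hv ⊢
          obtain ⟨i', h1, h2, h3⟩ := hedge v hv
          refine ⟨i', h1, h2.trans (Finset.subset_insert _ _), fun z hz hzv => ?_⟩
          have : z ≠ x := by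
            rintro rfl
            exact hxi.2 (h2 hz)
          simpa [this] using h3 z hz hzv
    have := hmax _ hbig
    rw [Finset.card_insert_of_notMem hxi.2] at this
    omega
  · have hps : ∀ i, ∃ p s, E i ⊆ S ∧ ¬ E i ⊆ Q → p ∈ E i ∧ s ∈ E i ∧ ρ p < ρ s ∧
        (∀ z ∈ E i, z ≠ p → ρ s ≤ ρ z) ∧ ρ p < K := by
      intro i
      by_cases hi : E i ⊆ S ∧ ¬ E i ⊆ Q
      swap
      · obtain ⟨q, -⟩ := hQ
        exact ⟨q, q, fun h => absurd h hi⟩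
      obtain ⟨w, hwi, hwQ⟩ := Finset.not_subset.1 hi.2
      have hwK : ρ w < K := (hρ w).2 (by simp [hwQ, hi.1 hwi])
      obtain ⟨p, hp, hpmin⟩ := Finset.exists_min_image (E i) ρ ⟨w, hwi⟩
      have hpK : ρ p < K := (hpmin w hwi).trans_lt hwK
      have hne : ((E i).erase p).Nonempty := by
        rw [← Finset.card_pos, Finset.card_erase_of_mem hp]
        have := hE i
        have := Finset.card_pos.2 ⟨p, hp⟩
        omega
      obtain ⟨s, hs, hsmin⟩ := Finset.exists_min_image _ ρ hne
      rw [Finset.mem_erase] at hs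
      refine ⟨p, s, fun _ => ⟨hp, hs.2, ?_, fun z hz hzp => hsmin z (by simp [hz, hzp]), hpK⟩⟩
      exact lt_of_le_of_ne (hpmin s hs.2) fun h => hs.1 (hinj p s hpK h).symm
    choose p s hps using hps
    refine ⟨p, s, ρ, K, hρ, fun i hi => (hps i hi).1, fun i hi => (hps i hi).2.1,
      fun i hi => (hps i hi).2.2.1, fun i hi => (hps i hi).2.2.2.1,
      fun i hi => (hps i hi).2.2.2.2, ?_, hinj⟩
    intro v hv
    obtain ⟨i, h1, h2, h3⟩ := hedge v hv
    have hiJ : E i ⊆ S ∧ ¬ E i ⊆ Q := ⟨h2, fun h => by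
      have := (hρ v).1 hv
      rw [Finset.mem_sdiff] at this
      exact this.2 (h h1)⟩
    refine ⟨i, hiJ, ?_⟩
    obtain ⟨h4, h5, h6, h7, h8⟩ := hps i hiJ
    by_contra hne
    have := h3 _ h4 hne
    have := h7 v h1 (Ne.symm hne)
    omega

section Reduction

variable {V ι : Type*} [Fintype ι] [DecidableEq V]

/-- An edge is nonmonochromatic if its vertices do not all have the same weight. -/
def Nonmonochromatic (E : ι → Finset V) (ω : ι → ℤ) (i : ι) : Prop :=
  ∃ u ∈ E i, ∃ v ∈ E i, vertexWeight E ω u ≠ vertexWeight E ω v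

/-- There is an edge weighting from `{1, 2, 3, 4, 5}` properly coloring all nonempty edges. -/
def HasProperWeighting (E : ι → Finset V) : Prop :=
  ∃ ω : ι → ℤ, (∀ i, 1 ≤ ω i ∧ ω i ≤ 5) ∧ ∀ i, (E i).Nonempty → Nonmonochromatic E ω i

/-- A hypergraph without twins on the vertex set `R`, with edges of size `2` and `3`. Empty edges
are allowed and carry no constraint. -/
structure TwinFree (E : ι → Finset V) (R : Finset V) : Prop where
  subset : ∀ i, E i ⊆ R
  card : ∀ i, (E i).card = 0 ∨ (E i).card = 2 ∨ (E i).card = 3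
  sep : ∀ u ∈ R, ∀ v ∈ R, u ≠ v → ∃ i, ¬ (u ∈ E i ↔ v ∈ E i)

variable {E : ι → Finset V} {R : Finset V}

omit [Fintype ι] in
theorem TwinFree.sdiff (hE : TwinFree E R) {S : Finset V} (hS : ∀ i, (E i \ S).card ≠ 1) :
    TwinFree (fun i => E i \ S) (R \ S) where
  subset i := Finset.sdiff_subset_sdiff (hE.subset i) subset_rfl
  card i := by
    have h1 := hE.card i
    have h2 := hS i
    have h3 := Finset.card_le_card (Finset.sdiff_subset (s := E i) (t := S))
    omega
  sep u hu v hv huv := by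
    rw [Finset.mem_sdiff] at hu hv
    obtain ⟨i, hi⟩ := hE.sep u hu.1 v hv.1 huv
    exact ⟨i, by simpa [hu.2, hv.2] using hi⟩

/-- A proper weighting after deleting `S` handles all edges that are not contained in `S`. -/
theorem HasProperWeighting.exists_of_sdiff {S : Finset V}
    (h : HasProperWeighting fun i => E i \ S) :
    ∃ ω₀ : ι → ℤ, (∀ i, 1 ≤ ω₀ i ∧ ω₀ i ≤ 5) ∧ ∀ ω : ι → ℤ,
      (∀ i, ¬ E i ⊆ S → ω i = ω₀ i) → ∀ i, ¬ E i ⊆ S → Nonmonochromatic E ω i := by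
  obtain ⟨ω₀, h1, h2⟩ := h
  refine ⟨ω₀, h1, fun ω hω i hi => ?_⟩
  have hW : ∀ v ∉ S, vertexWeight (fun i => E i \ S) ω₀ v = vertexWeight E ω v := by
    intro v hv
    refine Finset.sum_congr rfl fun j _ => ?_
    by_cases hj : v ∈ E j
    · simp [hj, hv, hω j fun h => hv (h hj)]
    · simp [hj]
  obtain ⟨u, hu, v, hv, huv⟩ := h2 i (Finset.sdiff_nonempty.2 hi)
  rw [Finset.mem_sdiff] at hu hv
  rw [hW u hu.2, hW v hv.2] at huv
  exact ⟨u, hu.1, v, hv.1, huv⟩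

omit [Fintype ι] [DecidableEq V] in
theorem TwinFree.two_le_card (hE : TwinFree E R) {i : ι} (hi : (E i).Nonempty) :
    2 ≤ (E i).card := by
  have := hE.card i
  have := Finset.card_pos.2 hi
  omega

theorem TwinFree.hasProperWeighting_of_no_pair (hE : TwinFree E R) {t : V}
    (ht : ∀ i, (E i).card = 2 → t ∉ E i)
    (ih : TwinFree (fun i => E i \ {t}) (R \ {t}) → HasProperWeighting fun i => E i \ {t}) :
    HasProperWeighting E := by
  have h1 : ∀ i, (E i \ {t}).card ≠ 1 := by
    intro i
    rw [Finset.sdiff_singleton_eq_erase]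
    have h2 := hE.card i
    by_cases h : t ∈ E i
    · have := ht i
      rw [Finset.card_erase_of_mem h]
      have := Finset.card_pos.2 ⟨t, h⟩
      have : (E i).card ≠ 2 := fun h' => ht i h' h
      omega
    · rw [Finset.erase_eq_of_notMem h]
      omega
  obtain ⟨ω, h2, h3⟩ := (ih (hE.sdiff h1)).exists_of_sdiff
  refine ⟨ω, h2, fun i hi => h3 ω (fun _ _ => rfl) i fun h => ?_⟩
  have h4 := Finset.card_le_card h
  have h5 := hE.two_le_card hi
  simp at h4
  omega

theorem exists_raise (b : ℤ) (Y : Finset V) (low : V → ℤ)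
    (hlow : ∀ y ∈ Y, low y % 4 = 0 ∨ low y % 4 = 1) (hY : 2 ≤ Y.card) :
    ∃ G ⊆ Y, ∀ y ∈ Y, b + 2 * G.card ≠ low y + 2 * (if y ∈ G then 1 else 0) := by
  by_cases h : ∃ y ∈ Y, low y = b
  swap
  · push Not at h
    exact ⟨∅, by simp, fun y hy => by simpa using (h y hy).symm⟩
  obtain ⟨z, hz, hzb⟩ := h
  have hb := hlow z hz
  by_cases h : ∃ y ∈ Y, low y ≠ b
  · obtain ⟨x, hx, hxb⟩ := h
    refine ⟨{x}, by simpa using hx, fun y hy => ?_⟩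
    have := hlow y hy
    by_cases hyx : y = x
    · subst hyx
      simpa using hxb.symm
    · simp only [Finset.card_singleton, Finset.mem_singleton, hyx, if_false]
      omega
  · push Not at h
    obtain ⟨G, hG, hc⟩ := Finset.exists_subset_card_eq hY
    refine ⟨G, hG, fun y hy => ?_⟩
    have := h y hy
    rw [hc]
    split_ifs <;> push_cast <;> omega

theorem TwinFree.hasProperWeighting_of_two_pairs [Fintype V] (hE : TwinFree E R)
    {t y₁ y₂ : V} {i₁ i₂ : ι} (h₁ : E i₁ = {t, y₁}) (h₂ : E i₂ = {t, y₂}) (ht₁ : y₁ ≠ t)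
    (ht₂ : y₂ ≠ t) (hy : y₁ ≠ y₂)
    (ih : ∀ S, t ∈ S → TwinFree (fun i => E i \ S) (R \ S) →
      HasProperWeighting fun i => E i \ S) :
    HasProperWeighting E := by
  classical
  obtain ⟨S, hQS, hS, p, s, ρ, K, hρ, hO⟩ :=
    exists_closed_orientedBy E (fun i => by have := hE.card i; omega) {t} (by simp)
  have htS : t ∈ S := hQS (by simp)
  obtain ⟨ω₀, hω₀, hout⟩ := (ih S htS (hE.sdiff hS)).exists_of_sdiff
  obtain ⟨ω, low, up, hP⟩ := hO.exists_processed ω₀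
  set J : Set ι := {i | E i ⊆ S ∧ ¬ E i ⊆ {t}} with hJ
  have hρt : K ≤ ρ t := by
    have := hρ t
    simp at this
    omega
  have hlt : ∀ z ∈ S, z ≠ t → ρ z < K := fun z hz hzt => (hρ z).2 (by simp [hz, hzt])
  set Y := backNeighbors J p s t with hYdef
  have hYK : ∀ y ∈ Y, ρ y < K := by
    intro y hy
    obtain ⟨i, hi, -, rfl⟩ := mem_backNeighbors.1 hy
    exact hO.p_lt i hi
  have hmem : ∀ y i, E i = {t, y} → y ≠ t → y ∈ Y := by
    intro y i hi hyt
    have hyS : y ∈ S := by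
      by_contra h
      apply hS i
      rw [hi, Finset.insert_sdiff_of_mem _ htS, Finset.sdiff_eq_self_of_disjoint (by simpa using h)]
      simp
    have hiJ : i ∈ J := by
      refine ⟨?_, fun h => ?_⟩
      · rw [hi]
        intro z hz
        rcases (by simpa using hz : z = t ∨ z = y) with rfl | rfl <;> assumption
      · have : y ∈ ({t} : Finset V) := h (by simp [hi])
        exact hyt (by simpa using this)
    have hp := hO.p_mem i hiJ
    have hs := hO.s_mem i hiJ
    have hpK := hO.p_lt i hiJ
    have hps := hO.lt i hiJ
    rw [hi, Finset.mem_insert, Finset.mem_singleton] at hp hs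
    have hpy : p i = y := by
      rcases hp with h | h
      · rw [h] at hpK
        omega
      · exact h
    refine mem_backNeighbors.2 ⟨i, hiJ, ?_, hpy⟩
    rcases hs with h | h
    · exact h
    · rw [h, hpy] at hps
      omega
  have hY2 : 2 ≤ Y.card := by
    rw [← Finset.card_pair hy]
    refine Finset.card_le_card fun z hz => ?_
    rcases (by simpa using hz : z = y₁ ∨ z = y₂) with rfl | rfl
    · exact hmem _ _ h₁ ht₁
    · exact hmem _ _ h₂ ht₂
  obtain ⟨G, hG, hGne⟩ := exists_raise (vertexWeight E ω t - 2 * ∑ y ∈ Y, up y) Y low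
    (fun y hy => hP.low_mod y (hYK y hy)) hY2
  obtain ⟨ω', hoff, -, hrange, hW, hWt⟩ := hP.exists_flip hO hρt hYK G hG
  rw [← hYdef] at hW hWt
  have hω' : ∀ i ∉ J, ω' i = ω₀ i := fun i hi => (hoff i hi).trans (hP.off i hi)
  have hWN : ∀ z, ρ z < K → ∃ g, (g = 0 ∨ g = 1) ∧ vertexWeight E ω' z = low z + 2 * g := by
    intro z hz
    rw [hW z hz, hP.weight z hz]
    split_ifs
    · exact ⟨1, Or.inr rfl, by ring⟩
    · exact ⟨0, Or.inl rfl, by ring⟩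
    · exact ⟨up z, hP.up_eq z hz, by ring⟩
  refine ⟨ω', fun i => ?_, fun i hi => ?_⟩
  · by_cases hiJ : i ∈ J
    · exact hrange i hiJ
    · rw [hω' i hiJ]
      exact hω₀ i
  by_cases hiS : E i ⊆ S
  swap
  · exact hout ω' (fun j hj => hω' j fun h => hj h.1) i hiS
  have hiJ : i ∈ J := by
    refine ⟨hiS, fun h => ?_⟩
    have h4 := Finset.card_le_card h
    have h5 := hE.two_le_card hi
    simp at h4
    omega
  refine ⟨p i, hO.p_mem i hiJ, s i, hO.s_mem i hiJ, ?_⟩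
  by_cases hst : s i = t
  · have hpY : p i ∈ Y := mem_backNeighbors.2 ⟨i, hiJ, hst, rfl⟩
    have h6 := hGne _ hpY
    rw [hst, hWt, hW _ (hYK _ hpY), hP.weight _ (hYK _ hpY), if_pos hpY]
    intro h
    apply h6
    linarith
  · have hsK := hlt _ (hiS (hO.s_mem i hiJ)) hst
    obtain ⟨g, hg, hgW⟩ := hWN _ (hO.p_lt i hiJ)
    obtain ⟨h, hh, hhW⟩ := hWN _ hsK
    rw [hgW, hhW]
    exact hP.vertexWeight_ne hO hiJ hsK hg hh

/-- The edges of size two form a perfect matching of `R`, with `m v` the partner of `v`. -/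
structure IsMate (E : ι → Finset V) (R : Finset V) (m : V → V) : Prop where
  mem : ∀ v ∈ R, m v ∈ R
  ne : ∀ v ∈ R, m v ≠ v
  invol : ∀ v ∈ R, m (m v) = v
  exists_pair : ∀ v ∈ R, ∃ i, E i = {v, m v}
  pair_eq : ∀ v ∈ R, ∀ i, (E i).card = 2 → v ∈ E i → E i = {v, m v}

omit [Fintype ι] in
theorem TwinFree.exists_isMate (hE : TwinFree E R)
    (h₁ : ∀ t ∈ R, ∃ i, (E i).card = 2 ∧ t ∈ E i)
    (h₂ : ∀ t y₁ y₂ i₁ i₂, E i₁ = {t, y₁} → E i₂ = {t, y₂} → y₁ ≠ t → y₂ ≠ t → y₁ = y₂) :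
    ∃ m, IsMate E R m := by
  have key : ∀ i t, (E i).card = 2 → t ∈ E i → ∃ y, y ≠ t ∧ E i = {t, y} := by
    intro i t hi ht
    obtain ⟨a, b, hab, hi⟩ := Finset.card_eq_two.1 hi
    rw [hi, Finset.mem_insert, Finset.mem_singleton] at ht
    rcases ht with rfl | rfl
    · exact ⟨b, hab.symm, hi⟩
    · exact ⟨a, hab, by rw [hi, Finset.pair_comm]⟩
  have hm : ∀ t, ∃ y, t ∈ R → y ≠ t ∧ ∃ i, E i = {t, y} := by
    intro t
    by_cases ht : t ∈ R
    · obtain ⟨i, hi, hti⟩ := h₁ t ht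
      obtain ⟨y, hy, hiy⟩ := key i t hi hti
      exact ⟨y, fun _ => ⟨hy, i, hiy⟩⟩
    · exact ⟨t, fun h => absurd h ht⟩
  choose m hm using hm
  have hmem : ∀ v ∈ R, m v ∈ R := by
    intro v hv
    obtain ⟨i, hi⟩ := (hm v hv).2
    exact hE.subset i (by simp [hi])
  refine ⟨m, hmem, fun v hv => (hm v hv).1, ?_, fun v hv => (hm v hv).2, ?_⟩
  · intro v hv
    obtain ⟨i, hi⟩ := (hm v hv).2
    obtain ⟨h3, j, hj⟩ := hm _ (hmem v hv)
    rw [Finset.pair_comm] at hi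
    exact h₂ _ _ _ _ _ hj hi h3 (hm v hv).1.symm
  · intro v hv i hi hvi
    obtain ⟨y, hy, hiy⟩ := key i v hi hvi
    obtain ⟨h3, j, hj⟩ := hm v hv
    rw [h₂ _ _ _ _ _ hj hiy h3 hy, hiy]

theorem TwinFree.hasProperWeighting_of_pair_mem (hE : TwinFree E R) {m : V → V}
    (hm : IsMate E R m) (h : ∀ i, (E i).card = 3 → ∃ y ∈ E i, m y ∈ E i) :
    HasProperWeighting E := by
  classical
  have hpair : ∀ i, (E i).Nonempty → ∃ y ∈ E i, m y ∈ E i := by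
    rintro i ⟨y, hy⟩
    rcases hE.card i with h0 | h2 | h3
    · rw [Finset.card_eq_zero] at h0
      simp [h0] at hy
    · refine ⟨y, hy, ?_⟩
      rw [hm.pair_eq y (hE.subset i hy) i h2 hy]
      simp
    · exact h i h3
  have key : ∀ A ⊆ R, ∃ ω : ι → ℤ, (∀ i, 1 ≤ ω i ∧ ω i ≤ 5) ∧
      ∀ x ∈ A, vertexWeight E ω x ≠ vertexWeight E ω (m x) := by
    intro A
    induction A using Finset.induction_on with
    | empty => exact fun _ => ⟨fun _ => 1, by simp, by simp⟩
    | insert x A _ ih =>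
      intro hA
      rw [Finset.insert_subset_iff] at hA
      obtain ⟨ω, hω, hωA⟩ := ih hA.2
      by_cases hx : vertexWeight E ω x = vertexWeight E ω (m x)
      swap
      · exact ⟨ω, hω, by simpa [hx] using hωA⟩
      obtain ⟨i, hi⟩ := hE.sep x hA.1 (m x) (hm.mem x hA.1) (hm.ne x hA.1).symm
      have hne : (E i).Nonempty := by
        rw [Finset.nonempty_iff_ne_empty]
        intro h0
        simp [h0] at hi
      obtain ⟨y, hy, hmy⟩ := hpair i hne
      have hyR := hE.subset i hy
      have hlone : ∀ z ∈ R, ¬ (z ∈ E i ↔ m z ∈ E i) → z = x ∨ z = m x := by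
        obtain ⟨l, hlR, hl, hml, hlx⟩ : ∃ l ∈ R, l ∈ E i ∧ m l ∉ E i ∧ (l = x ∨ l = m x) := by
          by_cases hxi : x ∈ E i
          · exact ⟨x, hA.1, hxi, by tauto, Or.inl rfl⟩
          · refine ⟨m x, hm.mem x hA.1, by tauto, ?_, Or.inr rfl⟩
            rwa [hm.invol x hA.1]
        have hly : l ≠ y := by
          rintro rfl
          exact hml hmy
        have hlmy : l ≠ m y := by
          rintro rfl
          rw [hm.invol y hyR] at hml
          exact hml hy
        have hEi : E i = {l, y, m y} := by
          symm
          apply Finset.eq_of_subset_of_card_le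
          · intro z hz
            rcases (by simpa using hz : z = l ∨ z = y ∨ z = m y) with rfl | rfl | rfl <;> assumption
          · rw [Finset.card_eq_three.2 ⟨l, y, m y, hly, hlmy, (hm.ne y hyR).symm, rfl⟩]
            have := hE.card i
            omega
        have hlone : ∀ z, z ∈ E i → m z ∉ E i → z = l := by
          intro z hz hmz
          rw [hEi] at hz
          rcases (by simpa using hz : z = l ∨ z = y ∨ z = m y) with rfl | rfl | rfl
          · rfl
          · exact absurd hmy hmz
          · rw [hm.invol y hyR] at hmz
            exact absurd hy hmz
        intro z hz hzi
        have hll : z = l ∨ z = m l := by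
          by_cases hz' : z ∈ E i
          · exact Or.inl (hlone z hz' (by tauto))
          · right
            rw [← hlone (m z) (by tauto) (by rwa [hm.invol z hz]), hm.invol z hz]
        rcases hlx with rfl | rfl
        · exact hll
        · rw [hm.invol x hA.1] at hll
          exact hll.symm
      obtain ⟨c, hc, hc'⟩ : ∃ c : ℤ, c ≠ 0 ∧ 1 ≤ ω i + c ∧ ω i + c ≤ 5 := by
        have := hω i
        by_cases h1 : ω i = 1
        · exact ⟨1, by omega⟩
        · exact ⟨-1, by omega⟩
      refine ⟨fun j => ω j + if j = i then c else 0, fun j => ?_, ?_⟩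
      · beta_reduce
        split_ifs with hji
        · rwa [hji]
        · simpa using hω j
      have hx' : vertexWeight E (fun j => ω j + if j = i then c else 0) x ≠
          vertexWeight E (fun j => ω j + if j = i then c else 0) (m x) := by
        simp only [vertexWeight_add, vertexWeight_single, hx]
        split_ifs with h3 h4 h4
        · exact absurd (iff_of_true h3 h4) hi
        · omega
        · omega
        · exact absurd (iff_of_false h3 h4) hi
      intro z hz
      by_cases hzx : z = x
      · rwa [hzx]
      by_cases hzmx : z = m x
      · rw [hzmx, hm.invol x hA.1]
        exact hx'.symm
      have hzA : z ∈ A := (Finset.mem_insert.1 hz).resolve_left hzx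
      have hzi : z ∈ E i ↔ m z ∈ E i := by
        by_contra h3
        rcases hlone z (hA.2 hzA) h3 with h4 | h4
        · exact hzx h4
        · exact hzmx h4
      have := hωA z hzA
      simp only [vertexWeight_add, vertexWeight_single, hzi]
      simpa using this
  obtain ⟨ω, hω, hωR⟩ := key R subset_rfl
  refine ⟨ω, hω, fun i hi => ?_⟩
  obtain ⟨y, hy, hmy⟩ := hpair i hi
  exact ⟨y, hy, m y, hmy, hωR y (hE.subset i hy)⟩

theorem exists_mem_Icc_one_five_ne (a b c : ℤ) :
    ∃ x : ℤ, (1 ≤ x ∧ x ≤ 5) ∧ x ≠ a ∧ x ≠ b ∧ x ≠ c := by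
  by_contra! h
  have h1 := h 1
  have h2 := h 2
  have h3 := h 3
  have h4 := h 4
  omega

/-- If `{x, u, w}` is an edge meeting three pairs, then the weights of this edge and of the three
pairs can be changed so that the six vertices involved get distinct weights. -/
theorem TwinFree.exists_reweighting (hE : TwinFree E R) {m : V → V} (hm : IsMate E R m)
    {f : ι} {x u w : V} (hf : E f = {x, u, w}) (hxu : x ≠ u) (hxw : x ≠ w) (huw : u ≠ w)
    (hmf : ∀ z ∈ E f, m z ∉ E f) (ω : ι → ℤ) :
    ∃ ω' : ι → ℤ, (∀ i, ¬ E i ⊆ {x, u, w, m x, m u, m w} → ω' i = ω i) ∧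
      (∀ i, (1 ≤ ω i ∧ ω i ≤ 5) → 1 ≤ ω' i ∧ ω' i ≤ 5) ∧
      ∀ q ∈ ({x, u, w, m x, m u, m w} : Finset V), ∀ q' ∈ ({x, u, w, m x, m u, m w} : Finset V),
        q ≠ q' → vertexWeight E ω' q ≠ vertexWeight E ω' q' := by
  classical
  have hxf : x ∈ E f := by simp [hf]
  have huf : u ∈ E f := by simp [hf]
  have hwf : w ∈ E f := by simp [hf]
  have hx := hE.subset f hxf
  have hu := hE.subset f huf
  have hw := hE.subset f hwf
  have hinj : ∀ a ∈ R, ∀ b ∈ R, a ≠ b → m a ≠ m b := fun a ha b hb hab h =>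
    hab (by rw [← hm.invol a ha, h, hm.invol b hb])
  have hmx := hmf x hxf
  have hmu := hmf u huf
  have hmw := hmf w hwf
  rw [hf] at hmx hmu hmw
  simp only [Finset.mem_insert, Finset.mem_singleton, not_or, ← ne_eq] at hmx hmu hmw
  have h1 := hinj x hx u hu hxu
  have h2 := hinj x hx w hw hxw
  have h3 := hinj u hu w hw huw
  obtain ⟨ix, hix⟩ := hm.exists_pair x hx
  obtain ⟨iu, hiu⟩ := hm.exists_pair u hu
  obtain ⟨iw, hiw⟩ := hm.exists_pair w hw
  have hneE : ∀ i j : ι, ∀ z, z ∈ E i → z ∉ E j → i ≠ j := by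
    rintro i j z h h' rfl
    exact h' h
  have e1 : f ≠ ix := hneE f ix u huf (by simp [hix, hxu.symm, hmx.2.1.symm])
  have e2 : f ≠ iu := hneE f iu x hxf (by simp [hiu, hxu, hmu.1.symm])
  have e3 : f ≠ iw := hneE f iw x hxf (by simp [hiw, hxw, hmw.1.symm])
  have e4 : ix ≠ iu := hneE ix iu x (by simp [hix]) (by simp [hiu, hxu, hmu.1.symm])
  have e5 : ix ≠ iw := hneE ix iw x (by simp [hix]) (by simp [hiw, hxw, hmw.1.symm])
  have e6 : iu ≠ iw := hneE iu iw u (by simp [hiu]) (by simp [hiw, huw, hmw.2.1.symm])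
  set ωb : ι → ℤ := fun i => if i = f ∨ i = ix ∨ i = iu ∨ i = iw then 0 else ω i with hωb
  set B := vertexWeight E ωb with hB
  obtain ⟨F, hF, hFx, hFu, hFw⟩ :=
    exists_mem_Icc_one_five_ne (B (m x) - B x) (B (m u) - B u) (B (m w) - B w)
  obtain ⟨a, b, c, ha, hb, hc, hab, hac, hbc⟩ := disjointTranslates (B x + F) (B (m x)) (B u + F)
    (B (m u)) (B w + F) (B (m w)) (by omega) (by omega) (by omega)
  set ω' : ι → ℤ := fun i => (((ωb i + if i = f then F else 0) + if i = ix then a else 0) +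
    if i = iu then b else 0) + if i = iw then c else 0 with hω'
  have hvalue : ∀ i, (i = f ∧ ω' i = F) ∨ (i = ix ∧ ω' i = a) ∨ (i = iu ∧ ω' i = b) ∨
      (i = iw ∧ ω' i = c) ∨ ((i ≠ f ∧ i ≠ ix ∧ i ≠ iu ∧ i ≠ iw) ∧ ω' i = ω i) := by
    intro i
    by_cases k1 : i = f
    · subst k1
      simp [hω', hωb, e1, e2, e3]
    by_cases k2 : i = ix
    · subst k2
      simp [hω', hωb, k1, e4, e5]
    by_cases k3 : i = iu
    · subst k3
      simp [hω', hωb, k1, k2, e6]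
    by_cases k4 : i = iw
    · subst k4
      simp [hω', hωb, k1, k2, k3]
    simp [hω', hωb, k1, k2, k3, k4]
  have hW : ∀ z, vertexWeight E ω' z = (((B z + if z ∈ E f then F else 0) +
      if z ∈ E ix then a else 0) + if z ∈ E iu then b else 0) + if z ∈ E iw then c else 0 := by
    intro z
    simp only [hω', vertexWeight_add, vertexWeight_single, hB]
  refine ⟨ω', fun i hi => ?_, fun i hi => ?_, ?_⟩
  · rcases hvalue i with h | h | h | h | h
    · exact absurd (by rw [h.1, hf]; intro z; simp; tauto) hi
    · exact absurd (by rw [h.1, hix]; intro z; simp; tauto) hi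
    · exact absurd (by rw [h.1, hiu]; intro z; simp; tauto) hi
    · exact absurd (by rw [h.1, hiw]; intro z; simp; tauto) hi
    · exact h.2
  · rcases hvalue i with h | h | h | h | h <;> rw [h.2] <;> assumption
  · have Wx : vertexWeight E ω' x = B x + F + a := by
      simp [hW, hf, hix, hiu, hiw, hxu, hxw, hmu.1.symm, hmw.1.symm]
    have Wu : vertexWeight E ω' u = B u + F + b := by
      simp [hW, hf, hix, hiu, hiw, hxu.symm, huw, hmx.2.1.symm, hmw.2.1.symm]
    have Ww : vertexWeight E ω' w = B w + F + c := by
      simp [hW, hf, hix, hiu, hiw, hxw.symm, huw.symm, hmx.2.2.symm, hmu.2.2.symm]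
    have Wmx : vertexWeight E ω' (m x) = B (m x) + a := by
      simp [hW, hf, hix, hiu, hiw, hmx, h1, h2]
    have Wmu : vertexWeight E ω' (m u) = B (m u) + b := by
      simp [hW, hf, hix, hiu, hiw, hmu, h1.symm, h3]
    have Wmw : vertexWeight E ω' (m w) = B (m w) + c := by
      simp [hW, hf, hix, hiu, hiw, hmw, h2.symm, h3.symm]
    have Dx : vertexWeight E ω' x ≠ vertexWeight E ω' (m x) := by
      clear hab hac hbc
      omega
    have Du : vertexWeight E ω' u ≠ vertexWeight E ω' (m u) := by
      clear hab hac hbc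
      omega
    have Dw : vertexWeight E ω' w ≠ vertexWeight E ω' (m w) := by
      clear hab hac hbc
      omega
    rw [← Wx, ← Wmx, ← Wu, ← Wmu] at hab
    rw [← Wx, ← Wmx, ← Ww, ← Wmw] at hac
    rw [← Wu, ← Wmu, ← Ww, ← Wmw] at hbc
    obtain ⟨hab₁, hab₂, hab₃, hab₄⟩ := hab
    obtain ⟨hac₁, hac₂, hac₃, hac₄⟩ := hac
    obtain ⟨hbc₁, hbc₂, hbc₃, hbc₄⟩ := hbc
    clear Wx Wu Ww Wmx Wmu Wmw hW hvalue
    generalize vertexWeight E ω' = W at *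
    intro q hq q' hq' hqq
    simp only [Finset.mem_insert, Finset.mem_singleton] at hq hq'
    rcases hq with rfl | rfl | rfl | rfl | rfl | rfl <;>
      rcases hq' with rfl | rfl | rfl | rfl | rfl | rfl <;>
        first | exact absurd rfl hqq | assumption | (apply Ne.symm; assumption)

theorem TwinFree.hasProperWeighting_of_transversal [Fintype V] (hE : TwinFree E R) {m : V → V}
    (hm : IsMate E R m) {f : ι} (hf : (E f).card = 3) (hmf : ∀ z ∈ E f, m z ∉ E f)
    (ih : ∀ S, E f ⊆ S → TwinFree (fun i => E i \ S) (R \ S) →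
      HasProperWeighting fun i => E i \ S) :
    HasProperWeighting E := by
  classical
  obtain ⟨x, u, w, hxu, hxw, huw, hfe⟩ := Finset.card_eq_three.1 hf
  obtain ⟨Q, hQ⟩ : ∃ Q : Finset V, Q = {x, u, w, m x, m u, m w} := ⟨_, rfl⟩
  have hfQ : E f ⊆ Q := by
    rw [hfe, hQ]
    intro z
    simp
    tauto
  have hQR : ∀ z ∈ Q, z ∈ R ∧ m z ∈ Q := by
    have hx := hE.subset f (show x ∈ E f by simp [hfe])
    have hu := hE.subset f (show u ∈ E f by simp [hfe])
    have hw := hE.subset f (show w ∈ E f by simp [hfe])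
    intro z hz
    rw [hQ] at hz ⊢
    simp only [Finset.mem_insert, Finset.mem_singleton] at hz
    rcases hz with rfl | rfl | rfl | rfl | rfl | rfl <;>
      simp [hx, hu, hw, hm.mem, hm.invol]
  obtain ⟨S, hQS, hS, p, s, ρ, K, hρ, hO⟩ :=
    exists_closed_orientedBy E (fun i => by have := hE.card i; omega) Q ⟨x, by simp [hQ]⟩
  obtain ⟨ω₀, hω₀, hout⟩ := (ih S (hfQ.trans hQS) (hE.sdiff hS)).exists_of_sdiff
  obtain ⟨ω, low, up, hP⟩ := hO.exists_processed ω₀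
  obtain ⟨ω', hsame, hrange, hne⟩ := hE.exists_reweighting hm hfe hxu hxw huw hmf ω
  rw [← hQ] at hsame hne
  have hω : ∀ i, 1 ≤ ω i ∧ ω i ≤ 5 := by
    intro i
    by_cases hi : E i ⊆ S ∧ ¬ E i ⊆ Q
    · exact hP.range i hi
    · rw [hP.off i hi]
      exact hω₀ i
  have hW : ∀ z, ρ z < K → vertexWeight E ω' z = low z + 2 * up z := by
    intro z hz
    rw [← hP.weight z hz]
    refine vertexWeight_congr fun i hi => hsame i fun h => ?_
    have := (hρ z).1 hz
    rw [Finset.mem_sdiff] at this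
    exact this.2 (h hi)
  refine ⟨ω', fun i => hrange i (hω i), fun i hi => ?_⟩
  have h2 := hE.two_le_card hi
  by_cases hiS : E i ⊆ S
  swap
  · refine hout ω' (fun j hj => ?_) i hiS
    rw [hsame j fun h => hj (h.trans hQS)]
    exact hP.off j fun h => hj h.1
  by_cases hiQ : E i ⊆ Q
  · obtain ⟨a, ha, b, hb, hab⟩ := Finset.one_lt_card.1 h2
    exact ⟨a, ha, b, hb, hne a (hiQ ha) b (hiQ hb) hab⟩
  have hiJ : i ∈ {i | E i ⊆ S ∧ ¬ E i ⊆ Q} := ⟨hiS, hiQ⟩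
  have hpi := hO.p_mem i hiJ
  have hsi := hO.s_mem i hiJ
  have hpK := hO.p_lt i hiJ
  by_cases hsK : ρ (s i) < K
  · refine ⟨p i, hpi, s i, hsi, ?_⟩
    rw [hW _ hpK, hW _ hsK]
    exact hP.vertexWeight_ne hO hiJ hsK (hP.up_eq _ hpK) (hP.up_eq _ hsK)
  have hrest : ∀ z ∈ (E i).erase (p i), z ∈ Q := by
    intro z hz
    rw [Finset.mem_erase] at hz
    have h3 := hO.le i hiJ z hz.2 hz.1
    have h4 := hρ z
    by_contra hzQ
    have := h4.2 (by simp [hzQ, hiS hz.2])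
    omega
  have hpQ : p i ∉ Q := by
    have := (hρ _).1 hpK
    rw [Finset.mem_sdiff] at this
    exact this.2
  have hcard : 1 < ((E i).erase (p i)).card := by
    rw [Finset.card_erase_of_mem hpi]
    have h3 : (E i).card ≠ 2 := by
      intro h3
      have h4 : s i ≠ p i := by
        intro h
        have := hO.lt i hiJ
        rw [h] at this
        omega
      have hsQ : s i ∈ Q := hrest _ (by simp [h4, hsi])
      have h5 := hm.pair_eq (s i) (hE.subset i hsi) i h3 hsi
      rw [h5, Finset.mem_insert, Finset.mem_singleton] at hpi
      rcases hpi with h | h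
      · exact h4 h.symm
      · rw [h] at hpQ
        exact hpQ (hQR _ hsQ).2
    omega
  obtain ⟨a, ha, b, hb, hab⟩ := Finset.one_lt_card.1 hcard
  exact ⟨a, Finset.mem_of_mem_erase ha, b, Finset.mem_of_mem_erase hb,
    hne a (hrest a ha) b (hrest b hb) hab⟩

theorem TwinFree.hasProperWeighting [Fintype V] (hE : TwinFree E R) : HasProperWeighting E := by
  classical
  induction R using Finset.strongInduction generalizing E with
  | H R IH =>
    have ih : ∀ S, (∃ t ∈ R, t ∈ S) → TwinFree (fun i => E i \ S) (R \ S) →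
        HasProperWeighting fun i => E i \ S := by
      rintro S ⟨t, htR, htS⟩ h
      refine IH (R \ S) (Finset.ssubset_iff_subset_ne.2 ⟨Finset.sdiff_subset, fun h' => ?_⟩) h
      rw [← h', Finset.mem_sdiff] at htR
      exact htR.2 htS
    by_cases h1 : ∀ t ∈ R, ∃ i, (E i).card = 2 ∧ t ∈ E i
    swap
    · push Not at h1
      obtain ⟨t, htR, ht⟩ := h1
      exact hE.hasProperWeighting_of_no_pair ht (ih {t} ⟨t, htR, by simp⟩)
    by_cases h2 : ∀ t y₁ y₂ i₁ i₂, E i₁ = {t, y₁} → E i₂ = {t, y₂} → y₁ ≠ t → y₂ ≠ t → y₁ = y₂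
    swap
    · push Not at h2
      obtain ⟨t, y₁, y₂, i₁, i₂, hi₁, hi₂, ht₁, ht₂, hy⟩ := h2
      exact hE.hasProperWeighting_of_two_pairs hi₁ hi₂ ht₁ ht₂ hy fun S htS =>
        ih S ⟨t, hE.subset i₁ (by simp [hi₁]), htS⟩
    obtain ⟨m, hm⟩ := hE.exists_isMate h1 h2
    by_cases h3 : ∀ i, (E i).card = 3 → ∃ y ∈ E i, m y ∈ E i
    · exact hE.hasProperWeighting_of_pair_mem hm h3
    · push Not at h3
      obtain ⟨f, hf, hmf⟩ := h3
      obtain ⟨x, hx⟩ : (E f).Nonempty := Finset.card_pos.1 (by omega)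
      exact hE.hasProperWeighting_of_transversal hm hf hmf fun S hS =>
        ih S ⟨x, hE.subset f hx, hS hx⟩

/-- Choosing a representative from each class of twins gives a twin-free hypergraph. -/
theorem exists_twinFree [Fintype V] (E : ι → Finset V)
    (hsize : ∀ i, (E i).card = 2 ∨ (E i).card = 3)
    (htwins : ∀ i, ¬ (∀ u ∈ E i, ∀ v ∈ E i, ∀ j, (u ∈ E j ↔ v ∈ E j))) :
    ∃ R : Finset V, TwinFree (fun i => E i ∩ R) R ∧ ∀ i, (E i ∩ R).Nonempty := by
  classical
  let r : Setoid V := Setoid.ker fun v => {j | v ∈ E j}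
  have hr : ∀ u v, r u v ↔ ∀ j, (u ∈ E j ↔ v ∈ E j) := fun u v => Set.ext_iff
  let c : V → V := fun v => (Quotient.mk r v).out
  have hc : ∀ v j, c v ∈ E j ↔ v ∈ E j := fun v => (hr _ _).1 (Quotient.mk_out v)
  have hcR : ∀ v, c v ∈ Finset.univ.image c := fun v => Finset.mem_image_of_mem _ (by simp)
  have hne : ∀ i, (E i ∩ Finset.univ.image c).Nonempty := by
    intro i
    have := hsize i
    obtain ⟨v, hv⟩ : (E i).Nonempty := Finset.card_pos.1 (by omega)
    exact ⟨c v, Finset.mem_inter.2 ⟨(hc v i).2 hv, hcR v⟩⟩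
  refine ⟨Finset.univ.image c, ⟨fun i => Finset.inter_subset_right, fun i => ?_, ?_⟩, hne⟩
  · have h1 := hsize i
    have h2 := Finset.card_le_card (Finset.inter_subset_left (s₁ := E i) (s₂ := Finset.univ.image c))
    have h3 := Finset.card_pos.2 (hne i)
    have h4 : (E i ∩ Finset.univ.image c).card ≠ 1 := by
      intro h4
      obtain ⟨a, ha⟩ := Finset.card_eq_one.1 h4
      have h5 : ∀ u ∈ E i, c u = a := by
        intro u hu
        have : c u ∈ E i ∩ Finset.univ.image c := Finset.mem_inter.2 ⟨(hc u i).2 hu, hcR u⟩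
        rwa [ha, Finset.mem_singleton] at this
      refine htwins i fun u hu v hv j => ?_
      rw [← hc u j, ← hc v j, h5 u hu, h5 v hv]
    omega
  · intro u hu v hv huv
    by_contra! h
    apply huv
    obtain ⟨a, -, rfl⟩ := Finset.mem_image.1 hu
    obtain ⟨b, -, rfl⟩ := Finset.mem_image.1 hv
    have hab : r a b := (hr a b).2 fun j => by simpa [hcR, hc] using h j
    simp only [c]
    rw [Quotient.sound hab]

end Reduction

/-- For every hypergraph `H` (multiple edges allowed, given by an indexed
family `E : ι → Finset V`) in which every edge has size `2` or `3` and no edge consists of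
twins, there is an edge weighting `ω : ι → {1,2,3,4,5}` such that the induced vertex
weights `ω(v) = ∑_{e ∋ v} ω(e)` properly color `V`: every edge contains two vertices with
different induced weights. -/
theorem vertex_coloring_weighting_of_edge_size_two_three {V ι : Type*} [Fintype V]
    [Fintype ι] [DecidableEq V] (E : ι → Finset V)
    (hsize : ∀ i, (E i).card = 2 ∨ (E i).card = 3)
    (htwins : ∀ i, ¬ (∀ u ∈ E i, ∀ v ∈ E i, ∀ j, (u ∈ E j ↔ v ∈ E j))) :
    ∃ ω : ι → ℕ, (∀ i, 1 ≤ ω i ∧ ω i ≤ 5) ∧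
      ∀ i, ∃ u ∈ E i, ∃ v ∈ E i,
        (∑ j, if u ∈ E j then ω j else 0) ≠ (∑ j, if v ∈ E j then ω j else 0) := by
  obtain ⟨R, hR, hne⟩ := exists_twinFree E hsize htwins
  obtain ⟨ω, hω, hproper⟩ := hR.hasProperWeighting
  have hW : ∀ v ∈ R, vertexWeight (fun i => E i ∩ R) ω v =
      ((∑ j, if v ∈ E j then (ω j).toNat else 0 : ℕ) : ℤ) := by
    intro v hv
    rw [Nat.cast_sum]
    refine Finset.sum_congr rfl fun j _ => ?_
    have := hω j
    by_cases h : v ∈ E j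
    · simp [h, hv]
      omega
    · simp [h]
  refine ⟨fun i => (ω i).toNat, fun i => by have := hω i; beta_reduce; omega, fun i => ?_⟩
  obtain ⟨u, hu, v, hv, huv⟩ := hproper i (hne i)
  rw [Finset.mem_inter] at hu hv
  rw [hW u hu.2, hW v hv.2] at huv
  exact ⟨u, hu.1, v, hv.1, fun h => huv (by exact_mod_cast h)⟩
end
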